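/- arXiv:1706.01866 — 2 statements merged into one kernel-verified Lean document; each statement's English description precedes it below -/
import Mathlib

section
/- There is a constant c > 0 such that for all sufficiently large n, with k = k₀(n) − 4, the expected maximum size of a packing of k-cliques in G_{n,1/2} satisfies E[ν_k(G_{n,1/2})] ≥ c·(n²/k⁴)·log k. -/
/-- `fExp n k` is the expected number of `k`-cliques in `G_{n,1/2}`,
i.e. `C(n,k) · 2^{-C(k,2)}`. -/
noncomputable def fExp (n k : ℕ) : ℝ := (n.choose k : ℝ) / 2 ^ (k.choose 2)

/-- `kZero n = min {k : fExp n k < 1}`. -/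
noncomputable def kZero (n : ℕ) : ℕ := sInf {k | fExp n k < 1}

/-- `P` is a packing of `k`-cliques in the graph `G` on `{1,…,n}`. -/
def IsCliquePacking (n k : ℕ) (G : SimpleGraph (Fin n)) (P : Finset (Finset (Fin n))) : Prop :=
  (∀ A ∈ P, A.card = k ∧ G.IsClique (A : Set (Fin n))) ∧
    ∀ A ∈ P, ∀ B ∈ P, A ≠ B → (A ∩ B).card ≤ 1

/-- `nuPack n k G` is the maximum size of a packing of `k`-cliques in `G`. -/
noncomputable def nuPack (n k : ℕ) (G : SimpleGraph (Fin n)) : ℕ :=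
  sSup {m | ∃ P, IsCliquePacking n k G P ∧ P.card = m}

/-- The expectation of `ν_k` over the uniform random graph `G_{n,1/2}`. -/
noncomputable def expNu (n k : ℕ) : ℝ :=
  (∑ G : SimpleGraph (Fin n), (nuPack n k G : ℝ)) / (Nat.card (SimpleGraph (Fin n)) : ℝ)


lemma log_le_of_two_pow (D : ℝ) (hD : 1 ≤ D) (x : ℕ) :
    Real.log D / 8 * (2 ^ x + 1) ≤ D + x * 2 ^ (x - 1) := by
  have hD0 : 0 < D := by linarith
  set s := Real.sqrt D with hs
  have hs1 : 1 ≤ s := Real.one_le_sqrt.2 hD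
  have hss : s * s = D := Real.mul_self_sqrt hD0.le
  have hlog : Real.log D = 2 * Real.log s := by
    rw [← hss, Real.log_mul (by positivity) (by positivity)]; ring
  have hls : Real.log s ≤ s - 1 := Real.log_le_sub_one_of_pos (by linarith)
  have hls0 : 0 ≤ Real.log s := Real.log_nonneg hs1
  have hx1 : (1 : ℝ) ≤ 2 ^ x := one_le_pow₀ (by norm_num)
  rw [hlog]
  rcases le_or_gt ((2 : ℝ) ^ x) s with h | h
  · have : (0 : ℝ) ≤ x * 2 ^ (x - 1) := by positivity
    nlinarith
  · have hx : Real.log s ≤ x := by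
      have h1 : Real.log s ≤ Real.log (2 ^ x) := Real.log_le_log (by linarith) h.le
      rw [Real.log_pow] at h1
      have h2 : Real.log 2 ≤ 1 := by linarith [Real.log_two_lt_d9]
      have h3 : (0 : ℝ) ≤ x := by positivity
      nlinarith
    rcases Nat.eq_zero_or_pos x with rfl | hpos
    · simp at h; linarith
    · obtain ⟨y, rfl⟩ : ∃ y, x = y + 1 := ⟨x - 1, by omega⟩
      simp only [Nat.add_sub_cancel]
      have hy : (1 : ℝ) ≤ 2 ^ y := one_le_pow₀ (by norm_num)
      rw [pow_succ] at *
      push_cast at *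
      have : Real.log s * 2 ^ y ≤ (y + 1) * 2 ^ y := by gcongr
      nlinarith

open Finset in
lemma sum_indep_fiber {W : Type*} [Fintype W] [DecidableEq W] (G : SimpleGraph W)
    [DecidableRel G.Adj] (htri : ∀ a b c, G.Adj a b → G.Adj b c → ¬ G.Adj a c) (D : ℝ)
    (hD : 1 ≤ D) (v : W) (H : Finset W) (hH : ∀ a ∈ H, ∀ b ∈ H, ¬ G.Adj a b)
    (hv : v ∉ H) (hvN : ∀ a ∈ H, ¬ G.Adj v a) :
    ∑ S ∈ univ.filter (fun S : Finset W => (∀ a ∈ S, ∀ b ∈ S, ¬ G.Adj a b) ∧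
        S.filter (fun a => a ≠ v ∧ ¬ G.Adj v a) = H), Real.log D / 8 ≤
    ∑ S ∈ univ.filter (fun S : Finset W => (∀ a ∈ S, ∀ b ∈ S, ¬ G.Adj a b) ∧
        S.filter (fun a => a ≠ v ∧ ¬ G.Adj v a) = H),
      ((if v ∈ S then D else 0) + ((S.filter (fun a => G.Adj v a)).card : ℝ)) := by
  set X := univ.filter (fun a => G.Adj v a ∧ ∀ b ∈ H, ¬ G.Adj a b) with hX
  have hfib : univ.filter (fun S : Finset W => (∀ a ∈ S, ∀ b ∈ S, ¬ G.Adj a b) ∧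
        S.filter (fun a => a ≠ v ∧ ¬ G.Adj v a) = H) =
      insert (insert v H) (X.powerset.image (H ∪ ·)) := by
    ext S
    simp only [mem_filter, mem_univ, true_and, mem_insert, mem_image, mem_powerset]
    constructor
    · rintro ⟨hS, rfl⟩
      by_cases hvS : v ∈ S
      · left
        ext a
        simp only [mem_insert, mem_filter]
        constructor
        · intro ha
          by_cases hav : a = v
          · exact Or.inl hav
          · exact Or.inr ⟨ha, hav, hS v hvS a ha⟩
        · rintro (rfl | ⟨h, -⟩) <;> assumption
      · right
        refine ⟨S.filter (fun a => G.Adj v a), ?_, ?_⟩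
        · intro a
          simp only [hX, mem_filter, mem_univ, true_and]
          exact fun ⟨h1, h2⟩ => ⟨h2, fun b hb => hS a h1 b hb.1⟩
        · ext a
          simp only [mem_union, mem_filter]
          constructor
          · rintro (h | h) <;> exact h.1
          · intro ha
            have : a ≠ v := by rintro rfl; exact hvS ha
            tauto
    · rintro (rfl | ⟨Y, hY, rfl⟩)
      · refine ⟨?_, ?_⟩
        · intro a ha b hb
          rw [mem_insert] at ha hb
          rcases ha with rfl | ha <;> rcases hb with rfl | hb
          · exact G.irrefl
          · exact hvN b hb
          · exact fun h => hvN a ha h.symm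
          · exact hH a ha b hb
        · ext a
          simp only [mem_filter, mem_insert]
          constructor
          · tauto
          · intro ha
            exact ⟨Or.inr ha, by rintro rfl; exact hv ha, hvN a ha⟩
      · have hY' : ∀ a ∈ Y, G.Adj v a ∧ ∀ b ∈ H, ¬ G.Adj a b := by
          intro a ha
          have := hY ha
          simpa [hX] using this
        refine ⟨?_, ?_⟩
        · intro a ha b hb
          rw [mem_union] at ha hb
          rcases ha with ha | ha <;> rcases hb with hb | hb
          · exact hH a ha b hb
          · exact fun h => (hY' b hb).2 a ha h.symm
          · exact (hY' a ha).2 b hb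
          · exact fun h => htri v a b (hY' a ha).1 h (hY' b hb).1
        · ext a
          simp only [mem_filter, mem_union]
          constructor
          · rintro ⟨h | h, h2, h3⟩
            · exact h
            · exact absurd (hY' a h).1 h3
          · intro ha
            exact ⟨Or.inl ha, by rintro rfl; exact hv ha, hvN a ha⟩
  have hdisj : ∀ Y ∈ X.powerset, Disjoint H Y := by
    intro Y hY
    rw [disjoint_left]
    intro a ha haY
    have := mem_powerset.1 hY haY
    simp only [hX, mem_filter] at this
    exact hvN a ha this.2.1
  have hvX : v ∉ X := by simp [hX]
  have hinj : Set.InjOn (H ∪ ·) (X.powerset : Set (Finset W)) := by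
    intro Y hY Z hZ h
    simp only at h
    have h1 := hdisj Y (by simpa using hY)
    have h2 := hdisj Z (by simpa using hZ)
    rw [← union_sdiff_cancel_left h1, h, union_sdiff_cancel_left h2]
  have hnot : insert v H ∉ X.powerset.image (H ∪ ·) := by
    simp only [mem_image, mem_powerset, not_exists, not_and]
    intro Y hY h
    have : v ∈ H ∪ Y := by rw [h]; simp
    rw [mem_union] at this
    exact this.elim hv (fun h' => hvX (hY h'))
  rw [hfib, sum_insert hnot, sum_insert hnot, sum_image hinj, sum_image hinj]
  have hterm : ∀ Y ∈ X.powerset, ((if v ∈ H ∪ Y then D else 0) +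
      (((H ∪ Y).filter (fun a => G.Adj v a)).card : ℝ)) = (Y.card : ℝ) := by
    intro Y hY
    rw [mem_powerset] at hY
    have h1 : v ∉ H ∪ Y := by
      rw [mem_union]; exact fun h => h.elim hv (fun h' => hvX (hY h'))
    have h2 : (H ∪ Y).filter (fun a => G.Adj v a) = Y := by
      ext a
      simp only [mem_filter, mem_union]
      constructor
      · rintro ⟨h | h, h'⟩
        · exact absurd h' (hvN a h)
        · exact h
      · intro h
        have := hY h
        simp only [hX, mem_filter] at this
        exact ⟨Or.inr h, this.2.1⟩
    rw [if_neg h1, h2, zero_add]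
  rw [sum_congr rfl hterm]
  have h1 : ∑ Y ∈ X.powerset, (Y.card : ℝ) = X.card * 2 ^ (X.card - 1) := by
    have h := sum_powerset_apply_card (fun m => m) (x := X)
    simp only [smul_eq_mul] at h
    have h' := Nat.sum_range_mul_choose X.card
    have : ∑ Y ∈ X.powerset, Y.card = X.card * 2 ^ (X.card - 1) := by
      rw [h, ← h']
      exact sum_congr rfl fun i _ => mul_comm _ _
    exact_mod_cast this
  have h2 : (insert v H).filter (fun a => G.Adj v a) = ∅ := by
    ext a
    simp only [mem_filter, mem_insert, notMem_empty, iff_false, not_and]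
    rintro (rfl | h)
    · exact G.irrefl
    · exact hvN a h
  rw [h1, h2, if_pos (mem_insert_self v H), sum_const, card_powerset]
  have := log_le_of_two_pow D hD X.card
  simp only [nsmul_eq_mul, card_empty]
  push_cast
  linarith

open Finset in
theorem exists_indep_of_triangle_free {W : Type*} [Fintype W] [DecidableEq W]
    (G : SimpleGraph W) [DecidableRel G.Adj]
    (htri : ∀ a b c, G.Adj a b → G.Adj b c → ¬ G.Adj a c) (D : ℕ) (hD : 1 ≤ D)
    (hdeg : ∀ v, (univ.filter (fun a => G.Adj v a)).card ≤ D) :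
    ∃ S : Finset W, (∀ a ∈ S, ∀ b ∈ S, ¬ G.Adj a b) ∧
      (Fintype.card W : ℝ) * Real.log D ≤ 16 * D * S.card := by
  set I := univ.filter (fun S : Finset W => ∀ a ∈ S, ∀ b ∈ S, ¬ G.Adj a b) with hI
  have hDR : (1 : ℝ) ≤ D := by exact_mod_cast hD
  have hv : ∀ v : W, ∑ S ∈ I, Real.log D / 8 ≤
      ∑ S ∈ I, ((if v ∈ S then (D : ℝ) else 0) +
        ((S.filter (fun a => G.Adj v a)).card : ℝ)) := by
    intro v
    set g : Finset W → Finset W := fun S => S.filter (fun a => a ≠ v ∧ ¬ G.Adj v a) with hg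
    have hm : ∀ S ∈ I, g S ∈ I.image g := fun S hS => mem_image_of_mem g hS
    rw [← sum_fiberwise_of_maps_to hm, ← sum_fiberwise_of_maps_to hm]
    refine sum_le_sum fun H hH => ?_
    obtain ⟨T, hT, rfl⟩ := mem_image.1 hH
    simp only [hI, mem_filter, mem_univ, true_and] at hT
    have := sum_indep_fiber G htri D hDR v (g T)
      (fun a ha b hb => hT a (mem_filter.1 ha).1 b (mem_filter.1 hb).1)
      (by simp [hg]) (fun a ha => (mem_filter.1 ha).2.2)
    rw [hI, filter_filter]
    exact this
  have hsum : ∑ S ∈ I, ∑ v : W, Real.log D / 8 ≤ ∑ S ∈ I, 2 * (D : ℝ) * S.card := by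
    rw [sum_comm]
    refine (sum_le_sum fun v _ => hv v).trans ?_
    rw [sum_comm]
    refine sum_le_sum fun S _ => ?_
    rw [sum_add_distrib]
    have h1 : ∑ v : W, (if v ∈ S then (D : ℝ) else 0) = D * S.card := by
      simp [sum_ite_mem, mul_comm]
    have h2 : ∑ v : W, ((S.filter (fun a => G.Adj v a)).card : ℝ) ≤ D * S.card := by
      have : ∑ v : W, (S.filter (fun a => G.Adj v a)).card ≤ D * S.card := by
        simp only [card_filter]
        rw [sum_comm, mul_comm, ← smul_eq_mul]
        refine sum_le_card_nsmul _ _ _ fun a _ => ?_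
        rw [← card_filter]
        simpa only [G.adj_comm] using hdeg a
      exact_mod_cast this
    linarith
  have hne : I.Nonempty := ⟨∅, by simp [hI]⟩
  obtain ⟨S, hS, h⟩ := exists_le_of_sum_le hne hsum
  refine ⟨S, by simpa [hI] using hS, ?_⟩
  simp only [sum_const, card_univ, nsmul_eq_mul] at h
  linarith

open Finset in
lemma exists_indep_of_sparse {α : Type*} [DecidableEq α] (S : Finset α) (R Q : α → α → Prop)
    [DecidableRel R] [DecidableRel Q] (hR : ∀ a b, R a b → R b a) (hirr : ∀ a, ¬ R a a)
    (D : ℕ) (hD : 1 ≤ D) :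
    ∃ P ⊆ S, (∀ a ∈ P, ∀ b ∈ P, ¬ R a b ∧ ¬ Q a b) ∧
      Real.log D * ((S.card : ℝ) - ((S ×ˢ S).filter (fun x => Q x.1 x.2)).card
        - ((S ×ˢ S ×ˢ S).filter (fun x => R x.1 x.2.1 ∧ R x.2.1 x.2.2 ∧ R x.1 x.2.2)).card
        - ((S ×ˢ S).filter (fun x => R x.1 x.2)).card / D) ≤ 16 * D * P.card := by
  set FQ := (S ×ˢ S).filter (fun x => Q x.1 x.2) with hFQ
  set FT := (S ×ˢ S ×ˢ S).filter
    (fun x => R x.1 x.2.1 ∧ R x.2.1 x.2.2 ∧ R x.1 x.2.2) with hFT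
  set FR := (S ×ˢ S).filter (fun x => R x.1 x.2) with hFR
  set B3 := S.filter (fun a => D < (S.filter (fun b => R a b)).card) with hB3
  set V := ((S \ FQ.image Prod.fst) \ FT.image Prod.fst) \ B3 with hV
  have hDR : (1 : ℝ) ≤ D := by exact_mod_cast hD
  have hB3c : (B3.card : ℝ) ≤ FR.card / D := by
    rw [le_div_iff₀ (by linarith)]
    have h1 : ∑ a ∈ S, (S.filter (fun b => R a b)).card = FR.card := by
      rw [hFR, card_filter, sum_product]
      simp only [card_filter]
    have h2 : B3.card * D ≤ ∑ a ∈ S, (S.filter (fun b => R a b)).card := by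
      rw [← smul_eq_mul]
      calc B3.card • D ≤ ∑ a ∈ B3, (S.filter (fun b => R a b)).card :=
            card_nsmul_le_sum _ _ _ fun a ha => (mem_filter.1 ha).2.le
        _ ≤ _ := sum_le_sum_of_subset (filter_subset _ _)
    rw [h1] at h2
    exact_mod_cast h2
  have hVS : V ⊆ S := fun a ha => by
    simp only [hV, mem_sdiff] at ha
    exact ha.1.1.1
  have hVc : (S.card : ℝ) - FQ.card - FT.card - FR.card / D ≤ V.card := by
    have h1 := le_card_sdiff (FQ.image Prod.fst) S
    have h2 := le_card_sdiff (FT.image Prod.fst) (S \ FQ.image Prod.fst)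
    have h3 := le_card_sdiff B3 ((S \ FQ.image Prod.fst) \ FT.image Prod.fst)
    have h4 : (FQ.image Prod.fst).card ≤ FQ.card := card_image_le
    have h5 : (FT.image Prod.fst).card ≤ FT.card := card_image_le
    have : S.card ≤ V.card + FQ.card + FT.card + B3.card := by
      rw [hV]
      omega
    have : (S.card : ℝ) ≤ V.card + FQ.card + FT.card + B3.card := by exact_mod_cast this
    linarith
  let G : SimpleGraph V :=
    { Adj := fun a b => R a b
      symm := ⟨fun a b h => hR _ _ h⟩
      loopless := ⟨fun a h => hirr _ h⟩ }
  have : DecidableRel G.Adj := fun a b => inferInstanceAs (Decidable (R a b))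
  obtain ⟨T, hT, hTc⟩ := exists_indep_of_triangle_free G (by
    intro a b c hab hbc hac
    have ha := a.2
    simp only [hV, mem_sdiff, mem_image, not_exists, not_and] at ha
    refine ha.1.2 (a, b, c) ?_ rfl
    simp only [hFT, mem_filter, mem_product]
    exact ⟨⟨hVS a.2, hVS b.2, hVS c.2⟩, hab, hbc, hac⟩) D hD (by
    intro v
    have ha := v.2
    simp only [hV, hB3, mem_sdiff, mem_filter, not_and, not_lt] at ha
    refine le_trans ?_ (ha.2 (hVS v.2))
    rw [← card_image_of_injective _ Subtype.val_injective]
    refine card_le_card fun a => ?_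
    simp only [mem_image, mem_filter, mem_univ, true_and]
    rintro ⟨b, hb, rfl⟩
    exact ⟨hVS b.2, hb⟩)
  refine ⟨T.image Subtype.val, ?_, ?_, ?_⟩
  · intro a ha
    obtain ⟨b, -, rfl⟩ := mem_image.1 ha
    exact hVS b.2
  · intro a ha b hb
    obtain ⟨a, ha', rfl⟩ := mem_image.1 ha
    obtain ⟨b, hb', rfl⟩ := mem_image.1 hb
    refine ⟨hT a ha' b hb', fun h => ?_⟩
    have hav := a.2
    simp only [hV, mem_sdiff, mem_image, not_exists, not_and] at hav
    refine hav.1.1.2 (a, b) ?_ rfl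
    simp only [hFQ, mem_filter, mem_product]
    exact ⟨⟨hVS a.2, hVS b.2⟩, h⟩
  · rw [card_image_of_injective _ Subtype.val_injective]
    refine le_trans ?_ hTc
    rw [mul_comm, Fintype.card_coe]
    exact mul_le_mul_of_nonneg_right hVc (Real.log_nonneg hDR)

open Finset in
lemma sum_bernoulli_superset {α : Type*} [DecidableEq α] (U X : Finset α) (hX : X ⊆ U) (p : ℝ) :
    ∑ S ∈ U.powerset with X ⊆ S, p ^ S.card * (1 - p) ^ (U \ S).card = p ^ X.card := by
  have h := prod_add (fun _ => p) (fun i => if i ∈ X then 0 else 1 - p) U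
  have hl : ∏ i ∈ U, (p + if i ∈ X then 0 else 1 - p) = p ^ X.card := by
    have : ∀ i ∈ U, (p + if i ∈ X then 0 else 1 - p) = if i ∈ X then p else 1 := by
      intro i _
      split_ifs <;> ring
    rw [prod_congr rfl this, prod_ite_mem, inter_eq_right.2 hX, prod_const]
  rw [hl] at h
  rw [h, sum_filter]
  refine sum_congr rfl fun S hS => ?_
  rw [prod_const]
  split_ifs with hXS
  · congr 1
    rw [← prod_const]
    refine prod_congr rfl fun i hi => ?_
    rw [if_neg]
    exact fun h' => (mem_sdiff.1 hi).2 (hXS h')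
  · obtain ⟨i, hi, hiS⟩ := not_subset.1 hXS
    rw [prod_eq_zero (mem_sdiff.2 ⟨hX hi, hiS⟩) (by simp [hi]), mul_zero]

open Finset in
lemma sum_bernoulli_count {α β : Type*} [DecidableEq α] (U : Finset α) (p : ℝ) (F : Finset β)
    (φ : β → Finset α) (m : ℕ) (hφ : ∀ x ∈ F, φ x ⊆ U ∧ (φ x).card = m) :
    ∑ S ∈ U.powerset, p ^ S.card * (1 - p) ^ (U \ S).card * ((F.filter (φ · ⊆ S)).card : ℝ) =
      p ^ m * F.card := by
  have : ∀ S : Finset α, ((F.filter (φ · ⊆ S)).card : ℝ) = ∑ x ∈ F, if φ x ⊆ S then 1 else 0 := by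
    intro S
    simp
  simp only [this, mul_sum]
  rw [sum_comm]
  simp only [mul_ite, mul_one, mul_zero]
  have h2 : ∀ x ∈ F, ∑ S ∈ U.powerset,
      (if φ x ⊆ S then p ^ S.card * (1 - p) ^ (U \ S).card else 0) = p ^ m := by
    intro x hx
    rw [← sum_filter, sum_bernoulli_superset U _ (hφ x hx).1, (hφ x hx).2]
  rw [sum_congr rfl h2, sum_const, nsmul_eq_mul, mul_comm]

open Finset in
theorem exists_indep_of_sampling {α : Type*} [DecidableEq α] (U : Finset α)
    (R Q : α → α → Prop) [DecidableRel R] [DecidableRel Q] (hR : ∀ a b, R a b → R b a)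
    (hirr : ∀ a, ¬ R a a) (hQ : ∀ a, ¬ Q a a) (D : ℕ) (hD : 1 ≤ D) (p : ℝ) (hp0 : 0 ≤ p)
    (hp1 : p ≤ 1) :
    ∃ P ⊆ U, (∀ a ∈ P, ∀ b ∈ P, ¬ R a b ∧ ¬ Q a b) ∧
      Real.log D * (p * (U.card : ℝ) - p ^ 2 * ((U ×ˢ U).filter (fun x => Q x.1 x.2)).card
        - p ^ 3 * ((U ×ˢ U ×ˢ U).filter
            (fun x => R x.1 x.2.1 ∧ R x.2.1 x.2.2 ∧ R x.1 x.2.2)).card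
        - p ^ 2 * ((U ×ˢ U).filter (fun x => R x.1 x.2)).card / D) ≤ 16 * D * P.card := by
  set w : Finset α → ℝ := fun S => p ^ S.card * (1 - p) ^ (U \ S).card with hw
  have hw0 : ∀ S, 0 ≤ w S := fun S => by
    have : 0 ≤ 1 - p := by linarith
    positivity
  have hw1 : ∑ S ∈ U.powerset, w S = 1 := by
    have := sum_bernoulli_superset U ∅ (empty_subset _) p
    simpa using this
  set FQ := (U ×ˢ U).filter (fun x => Q x.1 x.2) with hFQ
  set FT := (U ×ˢ U ×ˢ U).filter
    (fun x => R x.1 x.2.1 ∧ R x.2.1 x.2.2 ∧ R x.1 x.2.2) with hFT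
  set FR := (U ×ˢ U).filter (fun x => R x.1 x.2) with hFR
  have hne : ∀ a b, R a b → a ≠ b := by rintro a b h rfl; exact hirr a h
  have hneQ : ∀ a b, Q a b → a ≠ b := by rintro a b h rfl; exact hQ a h
  have e1 := sum_bernoulli_count U p U (fun a => {a}) 1 (by simp)
  have e2 := sum_bernoulli_count U p FQ (fun x => {x.1, x.2}) 2 (by
    rintro ⟨a, b⟩ h
    simp only [hFQ, mem_filter, mem_product] at h
    exact ⟨by simp [insert_subset_iff, h.1.1, h.1.2], card_pair (hneQ _ _ h.2)⟩)
  have e3 := sum_bernoulli_count U p FT (fun x => {x.1, x.2.1, x.2.2}) 3 (by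
    rintro ⟨a, b, c⟩ h
    simp only [hFT, mem_filter, mem_product] at h
    exact ⟨by simp [insert_subset_iff, h.1.1, h.1.2],
      card_eq_three.2 ⟨a, b, c, hne _ _ h.2.1, hne _ _ h.2.2.2, hne _ _ h.2.2.1, rfl⟩⟩)
  have e4 := sum_bernoulli_count U p FR (fun x => {x.1, x.2}) 2 (by
    rintro ⟨a, b⟩ h
    simp only [hFR, mem_filter, mem_product] at h
    exact ⟨by simp [insert_subset_iff, h.1.1, h.1.2], card_pair (hne _ _ h.2)⟩)
  choose P hPS hPi hPc using fun S : Finset α => exists_indep_of_sparse S R Q hR hirr D hD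
  set M := p * (U.card : ℝ) - p ^ 2 * FQ.card - p ^ 3 * FT.card - p ^ 2 * FR.card / D with hM
  have key : ∑ S ∈ U.powerset, w S * (Real.log D * M) ≤
      ∑ S ∈ U.powerset, w S * (16 * D * (P S).card) := by
    rw [← sum_mul, hw1, one_mul]
    have h : Real.log D * M = ∑ S ∈ U.powerset, w S * (Real.log D *
        (((U.filter (({·} : α → Finset α) · ⊆ S)).card : ℝ)
          - (FQ.filter (fun x => ({x.1, x.2} : Finset α) ⊆ S)).card
          - (FT.filter (fun x => ({x.1, x.2.1, x.2.2} : Finset α) ⊆ S)).card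
          - (FR.filter (fun x => ({x.1, x.2} : Finset α) ⊆ S)).card / D)) := by
      rw [hM, ← e2, ← e3, ← e4, ← pow_one p, ← e1, sum_div, ← sum_sub_distrib,
        ← sum_sub_distrib, ← sum_sub_distrib, mul_sum]
      refine sum_congr rfl fun S _ => ?_
      simp only [hw, pow_one]
      ring
    rw [h]
    refine sum_le_sum fun S hS => mul_le_mul_of_nonneg_left ?_ (hw0 S)
    have hS' := mem_powerset.1 hS
    have f1 : U.filter (({·} : α → Finset α) · ⊆ S) = S := by
      ext a
      simp only [mem_filter, singleton_subset_iff]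
      exact ⟨fun h => h.2, fun h => ⟨hS' h, h⟩⟩
    have f2 : ∀ (T : α → α → Prop) [DecidableRel T],
        ((U ×ˢ U).filter (fun x => T x.1 x.2)).filter
          (fun x => ({x.1, x.2} : Finset α) ⊆ S) = (S ×ˢ S).filter (fun x => T x.1 x.2) := by
      intro T _
      ext ⟨a, b⟩
      simp only [mem_filter, mem_product, insert_subset_iff, singleton_subset_iff]
      exact ⟨fun h => ⟨h.2, h.1.2⟩, fun h => ⟨⟨⟨hS' h.1.1, hS' h.1.2⟩, h.2⟩, h.1⟩⟩
    have f3 : FT.filter (fun x => ({x.1, x.2.1, x.2.2} : Finset α) ⊆ S) =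
        (S ×ˢ S ×ˢ S).filter (fun x => R x.1 x.2.1 ∧ R x.2.1 x.2.2 ∧ R x.1 x.2.2) := by
      ext ⟨a, b, c⟩
      simp only [hFT, mem_filter, mem_product, insert_subset_iff, singleton_subset_iff]
      exact ⟨fun h => ⟨h.2, h.1.2⟩,
        fun h => ⟨⟨⟨hS' h.1.1, hS' h.1.2.1, hS' h.1.2.2⟩, h.2⟩, h.1⟩⟩
    rw [f1, hFQ, hFR, f2, f2, f3]
    exact hPc S
  by_contra! hcon
  refine absurd key (not_le.2 ?_)
  have hlt : ∀ S ∈ U.powerset, 16 * D * ((P S).card : ℝ) < Real.log D * M := fun S hS =>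
    hcon (P S) ((hPS S).trans (mem_powerset.1 hS)) (hPi S)
  refine sum_lt_sum (fun S hS => mul_le_mul_of_nonneg_left (hlt S hS).le (hw0 S)) ?_
  by_contra! hc
  have : ∑ S ∈ U.powerset, w S ≤ 0 := sum_nonpos fun S hS => by
    by_contra! hpos
    exact absurd (hc S hS) (not_le.2 (mul_lt_mul_of_pos_left (hlt S hS) hpos))
  linarith

/-- The unordered pairs of distinct elements of `A`. -/
def cliqueEdges {n : ℕ} (A : Finset (Fin n)) : Finset (Sym2 (Fin n)) :=
  A.offDiag.image Sym2.mk.uncurry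

lemma mk_mem_cliqueEdges {n : ℕ} (A : Finset (Fin n)) (a b : Fin n) :
    s(a, b) ∈ cliqueEdges A ↔ a ∈ A ∧ b ∈ A ∧ a ≠ b := by
  simp only [cliqueEdges, Finset.mem_image, Finset.mem_offDiag, Prod.exists,
    Function.uncurry_apply_pair, Sym2.eq_iff]
  constructor
  · rintro ⟨x, y, ⟨hx, hy, hxy⟩, ⟨rfl, rfl⟩ | ⟨rfl, rfl⟩⟩
    · exact ⟨hx, hy, hxy⟩
    · exact ⟨hy, hx, hxy.symm⟩
  · rintro ⟨ha, hb, hab⟩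
    exact ⟨a, b, ⟨ha, hb, hab⟩, Or.inl ⟨rfl, rfl⟩⟩

lemma card_cliqueEdges {n : ℕ} (A : Finset (Fin n)) :
    (cliqueEdges A).card = A.card.choose 2 :=
  Sym2.card_image_offDiag A

lemma cliqueEdges_inter {n : ℕ} (A B : Finset (Fin n)) :
    cliqueEdges A ∩ cliqueEdges B = cliqueEdges (A ∩ B) := by
  ext e
  induction e with
  | _ a b =>
    simp only [Finset.mem_inter, mk_mem_cliqueEdges]
    tauto

lemma cliqueEdges_subset_univ {n : ℕ} (A : Finset (Fin n)) :
    cliqueEdges A ⊆ cliqueEdges Finset.univ := by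
  intro e
  induction e with
  | _ a b =>
    simp only [mk_mem_cliqueEdges]
    simp +contextual

lemma isClique_iff_cliqueEdges {n : ℕ} (G : SimpleGraph (Fin n)) (A : Finset (Fin n)) :
    G.IsClique (A : Set (Fin n)) ↔ (cliqueEdges A : Set (Sym2 (Fin n))) ⊆ G.edgeSet := by
  constructor
  · intro h e
    induction e with
    | _ a b =>
      intro he
      rw [Finset.mem_coe, mk_mem_cliqueEdges] at he
      exact h he.1 he.2.1 he.2.2
  · intro h a ha b hb hab
    exact h (Finset.mem_coe.2 ((mk_mem_cliqueEdges A a b).2 ⟨ha, hb, hab⟩))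

open Finset Classical in
lemma card_graphs_containing {n : ℕ} (X : Finset (Sym2 (Fin n)))
    (hX : X ⊆ cliqueEdges (univ : Finset (Fin n))) :
    (((univ : Finset (SimpleGraph (Fin n))).filter
      (fun G => (X : Set (Sym2 (Fin n))) ⊆ G.edgeSet)).card : ℝ) =
      (Nat.card (SimpleGraph (Fin n)) : ℝ) * (1 / 2) ^ X.card := by
  set E := cliqueEdges (univ : Finset (Fin n)) with hE
  have hcount : ∀ Y : Finset (Sym2 (Fin n)), Y ⊆ E →
      (((univ : Finset (SimpleGraph (Fin n))).filter
        (fun G => (Y : Set (Sym2 (Fin n))) ⊆ G.edgeSet)).card : ℝ) * (1 / 2) ^ E.card =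
        (1 / 2) ^ Y.card := by
    intro Y hY
    rw [← sum_bernoulli_superset E Y hY (1 / 2)]
    have h1 : ∀ S ∈ E.powerset.filter (Y ⊆ ·),
        (1 / 2 : ℝ) ^ S.card * (1 - 1 / 2) ^ (E \ S).card = (1 / 2) ^ E.card := by
      intro S hS
      have hS' := mem_powerset.1 (mem_filter.1 hS).1
      rw [show (1 - 1 / 2 : ℝ) = 1 / 2 by norm_num, ← pow_add, add_comm,
        card_sdiff_add_card_eq_card hS']
    rw [sum_congr rfl h1, sum_const, nsmul_eq_mul]
    congr 2
    refine card_bij' (fun G _ => E.filter (· ∈ G.edgeSet))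
      (fun S _ => SimpleGraph.fromEdgeSet (S : Set (Sym2 (Fin n)))) ?_ ?_ ?_ ?_
    · intro G hG
      simp only [mem_filter, mem_univ, true_and, mem_powerset] at hG ⊢
      exact ⟨filter_subset _ _, fun e he => mem_filter.2 ⟨hY he, hG he⟩⟩
    · intro S hS
      simp only [mem_filter, mem_univ, true_and, mem_powerset] at hS ⊢
      intro e he
      rw [SimpleGraph.edgeSet_fromEdgeSet]
      refine ⟨hS.2 he, ?_⟩
      have := hY he
      induction e with
      | _ a b =>
        rw [hE, mk_mem_cliqueEdges] at this
        simpa using this.2.2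
    · intro G _
      ext a b
      simp only [SimpleGraph.fromEdgeSet_adj, coe_filter, Set.mem_ofPred_eq, hE,
        mk_mem_cliqueEdges, SimpleGraph.mem_edgeSet, mem_univ, true_and]
      exact ⟨fun h => h.1.2, fun h => ⟨⟨h.ne, h⟩, h.ne⟩⟩
    · intro S hS
      simp only [mem_filter, mem_powerset] at hS
      ext e
      have hSe := @hS.1 e
      induction e with
      | _ a b =>
        simp only [hE, mk_mem_cliqueEdges, mem_filter, SimpleGraph.mem_edgeSet,
          SimpleGraph.fromEdgeSet_adj, mem_coe, mem_univ, true_and] at hSe ⊢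
        tauto
  have h0 := hcount ∅ (empty_subset _)
  simp only [coe_empty, Set.empty_subset, filter_true, card_empty, pow_zero] at h0
  rw [Nat.card_eq_fintype_card, ← card_univ]
  have h2 := hcount X hX
  have hpos : (0 : ℝ) < (1 / 2) ^ E.card := by positivity
  apply mul_right_cancel₀ hpos.ne'
  rw [h2, mul_right_comm, h0, one_mul]

open Finset Classical in
lemma sum_graphs_count {n : ℕ} {β : Type*} (F : Finset β) (ψ : β → Finset (Sym2 (Fin n)))
    (hψ : ∀ x ∈ F, ψ x ⊆ cliqueEdges (univ : Finset (Fin n))) :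
    ∑ G : SimpleGraph (Fin n),
      ((F.filter (fun x => (ψ x : Set (Sym2 (Fin n))) ⊆ G.edgeSet)).card : ℝ) =
      (Nat.card (SimpleGraph (Fin n)) : ℝ) * ∑ x ∈ F, (1 / 2) ^ (ψ x).card := by
  rw [mul_sum]
  simp only [card_filter, Nat.cast_sum]
  rw [sum_comm]
  refine sum_congr rfl fun x hx => ?_
  rw [← card_graphs_containing _ (hψ x hx), card_filter, Nat.cast_sum]

lemma le_nuPack {n k : ℕ} {G : SimpleGraph (Fin n)} {P : Finset (Finset (Fin n))}
    (hP : IsCliquePacking n k G P) : P.card ≤ nuPack n k G := by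
  refine le_csSup ⟨(Finset.univ : Finset (Finset (Fin n))).card, ?_⟩ ⟨P, hP, rfl⟩
  rintro m ⟨Q, -, rfl⟩
  exact Finset.card_le_univ Q

open Finset in
theorem le_expNu (n k D : ℕ) (hD : 1 ≤ D) (p : ℝ) (hp0 : 0 ≤ p) (hp1 : p ≤ 1) :
    Real.log D * (p * ∑ A ∈ powersetCard k (univ : Finset (Fin n)), (1 / 2) ^ (cliqueEdges A).card
      - p ^ 2 * ∑ x ∈ (powersetCard k (univ : Finset (Fin n)) ×ˢ powersetCard k univ).filter
          (fun x => x.1 ≠ x.2 ∧ 3 ≤ (x.1 ∩ x.2).card),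
          (1 / 2) ^ (cliqueEdges x.1 ∪ cliqueEdges x.2).card
      - p ^ 3 * ∑ x ∈ (powersetCard k (univ : Finset (Fin n)) ×ˢ powersetCard k univ ×ˢ
          powersetCard k univ).filter
          (fun x => (x.1 ≠ x.2.1 ∧ (x.1 ∩ x.2.1).card = 2) ∧
            (x.2.1 ≠ x.2.2 ∧ (x.2.1 ∩ x.2.2).card = 2) ∧
            (x.1 ≠ x.2.2 ∧ (x.1 ∩ x.2.2).card = 2)),
          (1 / 2) ^ (cliqueEdges x.1 ∪ cliqueEdges x.2.1 ∪ cliqueEdges x.2.2).card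
      - p ^ 2 * (∑ x ∈ (powersetCard k (univ : Finset (Fin n)) ×ˢ powersetCard k univ).filter
          (fun x => x.1 ≠ x.2 ∧ (x.1 ∩ x.2).card = 2),
          (1 / 2) ^ (cliqueEdges x.1 ∪ cliqueEdges x.2).card) / D) ≤ 16 * D * expNu n k := by
  classical
  set M := powersetCard k (univ : Finset (Fin n)) with hM
  set FQ := (M ×ˢ M).filter (fun x => x.1 ≠ x.2 ∧ 3 ≤ (x.1 ∩ x.2).card) with hFQ
  set FT := (M ×ˢ M ×ˢ M).filter (fun x => (x.1 ≠ x.2.1 ∧ (x.1 ∩ x.2.1).card = 2) ∧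
            (x.2.1 ≠ x.2.2 ∧ (x.2.1 ∩ x.2.2).card = 2) ∧
            (x.1 ≠ x.2.2 ∧ (x.1 ∩ x.2.2).card = 2)) with hFT
  set FR := (M ×ˢ M).filter (fun x => x.1 ≠ x.2 ∧ (x.1 ∩ x.2).card = 2) with hFR
  have e1 := sum_graphs_count M (fun A => cliqueEdges A) fun _ _ => cliqueEdges_subset_univ _
  have e2 := sum_graphs_count FQ (fun x => cliqueEdges x.1 ∪ cliqueEdges x.2) fun _ _ =>
    union_subset (cliqueEdges_subset_univ _) (cliqueEdges_subset_univ _)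
  have e3 := sum_graphs_count FT
    (fun x => cliqueEdges x.1 ∪ cliqueEdges x.2.1 ∪ cliqueEdges x.2.2) fun _ _ =>
    union_subset (union_subset (cliqueEdges_subset_univ _) (cliqueEdges_subset_univ _))
      (cliqueEdges_subset_univ _)
  have e4 := sum_graphs_count FR (fun x => cliqueEdges x.1 ∪ cliqueEdges x.2) fun _ _ =>
    union_subset (cliqueEdges_subset_univ _) (cliqueEdges_subset_univ _)
  have hN : (0 : ℝ) < Nat.card (SimpleGraph (Fin n)) := by exact_mod_cast Nat.card_pos
  have key : ∀ G : SimpleGraph (Fin n), Real.log D *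
      (p * ((M.filter (fun A => (cliqueEdges A : Set (Sym2 (Fin n))) ⊆ G.edgeSet)).card : ℝ)
      - p ^ 2 * (FQ.filter (fun x => ((cliqueEdges x.1 ∪ cliqueEdges x.2 :
          Finset (Sym2 (Fin n))) : Set (Sym2 (Fin n))) ⊆ G.edgeSet)).card
      - p ^ 3 * (FT.filter (fun x => ((cliqueEdges x.1 ∪ cliqueEdges x.2.1 ∪ cliqueEdges x.2.2 :
          Finset (Sym2 (Fin n))) : Set (Sym2 (Fin n))) ⊆ G.edgeSet)).card
      - p ^ 2 * (FR.filter (fun x => ((cliqueEdges x.1 ∪ cliqueEdges x.2 :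
          Finset (Sym2 (Fin n))) : Set (Sym2 (Fin n))) ⊆ G.edgeSet)).card / D) ≤
      16 * D * nuPack n k G := by
    intro G
    set U := M.filter (fun A => (cliqueEdges A : Set (Sym2 (Fin n))) ⊆ G.edgeSet) with hU
    obtain ⟨P, hPU, hPi, hPc⟩ := exists_indep_of_sampling U
      (fun A B => A ≠ B ∧ (A ∩ B).card = 2) (fun A B => A ≠ B ∧ 3 ≤ (A ∩ B).card)
      (fun A B h => ⟨h.1.symm, by rw [inter_comm]; exact h.2⟩) (fun A h => h.1 rfl)
      (fun A h => h.1 rfl) D hD p hp0 hp1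
    have f2 : ∀ (T : Finset (Fin n) → Finset (Fin n) → Prop) [DecidableRel T],
        ((M ×ˢ M).filter (fun x => T x.1 x.2)).filter
          (fun x => ((cliqueEdges x.1 ∪ cliqueEdges x.2 :
            Finset (Sym2 (Fin n))) : Set (Sym2 (Fin n))) ⊆ G.edgeSet) =
          (U ×ˢ U).filter (fun x => T x.1 x.2) := by
      intro T _
      ext ⟨a, b⟩
      simp only [hU, mem_filter, mem_product, coe_union, Set.union_subset_iff]
      tauto
    have f3 : FT.filter (fun x => ((cliqueEdges x.1 ∪ cliqueEdges x.2.1 ∪ cliqueEdges x.2.2 :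
          Finset (Sym2 (Fin n))) : Set (Sym2 (Fin n))) ⊆ G.edgeSet) =
        (U ×ˢ U ×ˢ U).filter (fun x => (x.1 ≠ x.2.1 ∧ (x.1 ∩ x.2.1).card = 2) ∧
            (x.2.1 ≠ x.2.2 ∧ (x.2.1 ∩ x.2.2).card = 2) ∧
            (x.1 ≠ x.2.2 ∧ (x.1 ∩ x.2.2).card = 2)) := by
      ext ⟨a, b, c⟩
      simp only [hFT, hU, mem_filter, mem_product, coe_union, Set.union_subset_iff]
      tauto
    rw [hFQ, hFR, f2 (fun A B => A ≠ B ∧ 3 ≤ (A ∩ B).card),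
      f2 (fun A B => A ≠ B ∧ (A ∩ B).card = 2), f3]
    refine hPc.trans ?_
    have hpack : IsCliquePacking n k G P := by
      constructor
      · intro A hA
        have := hPU hA
        rw [hU, mem_filter, hM, mem_powersetCard] at this
        exact ⟨this.1.2, (isClique_iff_cliqueEdges G A).2 this.2⟩
      · intro A hA B hB hAB
        have := hPi A hA B hB
        have h1 : (A ∩ B).card ≠ 2 := fun h => this.1 ⟨hAB, h⟩
        have h2 : ¬ 3 ≤ (A ∩ B).card := fun h => this.2 ⟨hAB, h⟩
        omega
    have : (P.card : ℝ) ≤ nuPack n k G := by exact_mod_cast le_nuPack hpack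
    gcongr
  have hsum := sum_le_sum fun G (_ : G ∈ (univ : Finset (SimpleGraph (Fin n)))) => key G
  rw [← mul_sum, ← mul_sum, sum_sub_distrib, sum_sub_distrib, sum_sub_distrib, ← sum_div,
    ← mul_sum, ← mul_sum, ← mul_sum, ← mul_sum, e1, e2, e3, e4] at hsum
  rw [expNu]
  have hgoal := div_le_div_of_nonneg_right hsum hN.le
  rw [mul_div_assoc (16 * (D : ℝ))] at hgoal
  convert! hgoal using 1
  field_simp

lemma choose_mul_pow_le {n k : ℕ} (hkn : k ≤ n) (i : ℕ) :
    k.choose i * n ^ i ≤ n.choose i * k ^ i := by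
  induction i with
  | zero => simp
  | succ i ih =>
    refine Nat.le_of_mul_le_mul_right ?_ (Nat.succ_pos i)
    have h1 := Nat.choose_succ_right_eq k i
    have h2 := Nat.choose_succ_right_eq n i
    have h3 : (k - i) * n ≤ (n - i) * k := by
      rw [Nat.sub_mul, Nat.sub_mul, mul_comm n k]
      exact Nat.sub_le_sub_left (Nat.mul_le_mul_left i hkn) _
    calc k.choose (i + 1) * n ^ (i + 1) * (i + 1)
        = (k.choose (i + 1) * (i + 1)) * n ^ i * n := by ring
      _ = (k.choose i * n ^ i) * ((k - i) * n) := by rw [h1]; ring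
      _ ≤ (n.choose i * k ^ i) * ((n - i) * k) := Nat.mul_le_mul ih h3
      _ = (n.choose (i + 1) * (i + 1)) * k ^ i * k := by rw [h2]; ring
      _ = n.choose (i + 1) * k ^ (i + 1) * (i + 1) := by ring

lemma choose_sub_eq {n k i : ℕ} (hik : i ≤ k) (hkn : k ≤ n) :
    ((n - i).choose (k - i) : ℝ) = n.choose k * k.choose i / n.choose i := by
  have h : (0 : ℝ) < n.choose i := by exact_mod_cast Nat.choose_pos (hik.trans hkn)
  rw [eq_div_iff h.ne', mul_comm]
  exact_mod_cast (Nat.choose_mul hik).symm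

lemma choose_sub_le {n k i : ℕ} (hik : i ≤ k) (hkn : k ≤ n) (hn : 0 < n) :
    ((n - i).choose (k - i) : ℝ) ≤ n.choose k * ((k : ℝ) / n) ^ i := by
  rw [choose_sub_eq hik hkn, mul_div_assoc]
  have h : (0 : ℝ) < n.choose i := by exact_mod_cast Nat.choose_pos (hik.trans hkn)
  have hn' : (0 : ℝ) < n := by exact_mod_cast hn
  gcongr
  rw [div_pow, div_le_div_iff₀ h (by positivity), mul_comm ((k : ℝ) ^ i)]
  exact_mod_cast choose_mul_pow_le hkn i

open Finset in
lemma card_filter_inter_eq_le {n k i : ℕ} (hik : i ≤ k) (A : Finset (Fin n)) :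
    ((powersetCard k (univ : Finset (Fin n))).filter (fun B => (A ∩ B).card = i)).card ≤
      A.card.choose i * (n - i).choose (k - i) := by
  have hsub : (powersetCard k (univ : Finset (Fin n))).filter (fun B => (A ∩ B).card = i) ⊆
      (powersetCard i A).biUnion fun Y => (powersetCard k univ).filter (Y ⊆ ·) := by
    intro B hB
    rw [mem_filter] at hB
    exact mem_biUnion.2 ⟨A ∩ B, mem_powersetCard.2 ⟨inter_subset_left, hB.2⟩,
      mem_filter.2 ⟨hB.1, inter_subset_right⟩⟩
  refine (card_le_card hsub).trans (card_biUnion_le.trans ?_)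
  rw [← card_powersetCard, ← smul_eq_mul]
  refine sum_le_card_nsmul _ _ _ fun Y hY => ?_
  rw [mem_powersetCard] at hY
  rw [card_filter_powersetCard_subset _ _ _ (subset_univ _) (by omega), hY.2, card_univ,
    Fintype.card_fin]

open Finset in
lemma card_filter_three_le_inter_le {n k : ℕ} (hk : 3 ≤ k) (A : Finset (Fin n)) :
    ((powersetCard k (univ : Finset (Fin n))).filter (fun B => 3 ≤ (A ∩ B).card)).card ≤
      A.card.choose 3 * (n - 3).choose (k - 3) := by
  have hsub : (powersetCard k (univ : Finset (Fin n))).filter (fun B => 3 ≤ (A ∩ B).card) ⊆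
      (powersetCard 3 A).biUnion fun Y => (powersetCard k univ).filter (Y ⊆ ·) := by
    intro B hB
    rw [mem_filter] at hB
    obtain ⟨Y, hY, hYc⟩ := exists_subset_card_eq hB.2
    exact mem_biUnion.2 ⟨Y, mem_powersetCard.2 ⟨hY.trans inter_subset_left, hYc⟩,
      mem_filter.2 ⟨hB.1, hY.trans inter_subset_right⟩⟩
  refine (card_le_card hsub).trans (card_biUnion_le.trans ?_)
  rw [← card_powersetCard, ← smul_eq_mul]
  refine sum_le_card_nsmul _ _ _ fun Y hY => ?_
  rw [mem_powersetCard] at hY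
  rw [card_filter_powersetCard_subset _ _ _ (subset_univ _) (by omega), hY.2, card_univ,
    Fintype.card_fin]

open Finset in
lemma card_filter_inter_two_two_le {n k : ℕ} (hk : 3 ≤ k) (A B : Finset (Fin n))
    (hA : A.card = k) (hB : B.card = k) (hAB : (A ∩ B).card = 2) :
    ((powersetCard k (univ : Finset (Fin n))).filter
      (fun C => (B ∩ C).card = 2 ∧ (A ∩ C).card = 2)).card ≤
      (n - 2).choose (k - 2) + (2 * k) ^ 3 * (n - 3).choose (k - 3) := by
  have hsub : (powersetCard k (univ : Finset (Fin n))).filter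
      (fun C => (B ∩ C).card = 2 ∧ (A ∩ C).card = 2) ⊆
      (powersetCard k univ).filter (A ∩ B ⊆ ·) ∪
        (powersetCard k univ).filter (fun C => 3 ≤ ((A ∪ B) ∩ C).card) := by
    intro C hC
    rw [mem_filter] at hC
    rw [mem_union, mem_filter, mem_filter]
    by_cases h : 3 ≤ ((A ∪ B) ∩ C).card
    · exact Or.inr ⟨hC.1, h⟩
    · left
      refine ⟨hC.1, ?_⟩
      have h1 : A ∩ C = (A ∪ B) ∩ C :=
        eq_of_subset_of_card_le (inter_subset_inter_right subset_union_left) (by omega)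
      have h2 : B ∩ C = (A ∪ B) ∩ C :=
        eq_of_subset_of_card_le (inter_subset_inter_right subset_union_right) (by omega)
      have h3 : A ∩ C ⊆ A ∩ B := by
        intro x hx
        have hx' := hx
        rw [h1, ← h2] at hx'
        exact mem_inter.2 ⟨(mem_inter.1 hx).1, (mem_inter.1 hx').1⟩
      have h4 : A ∩ C = A ∩ B := eq_of_subset_of_card_le h3 (by omega)
      rw [← h4]
      exact inter_subset_right
  refine (card_le_card hsub).trans ((card_union_le _ _).trans ?_)
  gcongr
  · rw [card_filter_powersetCard_subset _ _ _ (subset_univ _) (by omega), hAB, card_univ,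
      Fintype.card_fin]
  · refine (card_filter_three_le_inter_le hk _).trans ?_
    gcongr
    refine (Nat.choose_le_choose 3 ?_).trans (Nat.choose_le_pow _ _)
    have := card_union_le A B
    omega

lemma card_cliqueEdges_union {n : ℕ} (A B : Finset (Fin n)) :
    (cliqueEdges A ∪ cliqueEdges B).card + (A ∩ B).card.choose 2 =
      A.card.choose 2 + B.card.choose 2 := by
  rw [← card_cliqueEdges, ← card_cliqueEdges A, ← card_cliqueEdges B, ← cliqueEdges_inter]
  exact Finset.card_union_add_card_inter _ _

lemma card_cliqueEdges_union_three {n : ℕ} (A B C : Finset (Fin n)) :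
    A.card.choose 2 + B.card.choose 2 + C.card.choose 2 ≤
      (cliqueEdges A ∪ cliqueEdges B ∪ cliqueEdges C).card + (A ∩ B).card.choose 2 +
        (A ∩ C).card.choose 2 + (B ∩ C).card.choose 2 := by
  have h1 := card_cliqueEdges_union A B
  have h2 := Finset.card_union_add_card_inter (cliqueEdges A ∪ cliqueEdges B) (cliqueEdges C)
  rw [Finset.union_inter_distrib_right, cliqueEdges_inter, cliqueEdges_inter,
    card_cliqueEdges C] at h2
  have h3 := Finset.card_union_le (cliqueEdges (A ∩ C)) (cliqueEdges (B ∩ C))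
  rw [card_cliqueEdges, card_cliqueEdges] at h3
  omega

open Finset in
lemma sum_clique_prob (n k : ℕ) :
    ∑ A ∈ powersetCard k (univ : Finset (Fin n)), (1 / 2 : ℝ) ^ (cliqueEdges A).card =
      fExp n k := by
  have : ∀ A ∈ powersetCard k (univ : Finset (Fin n)),
      (1 / 2 : ℝ) ^ (cliqueEdges A).card = (1 / 2) ^ k.choose 2 := by
    intro A hA
    rw [card_cliqueEdges, (mem_powersetCard.1 hA).2]
  rw [sum_congr rfl this, sum_const, card_powersetCard, card_univ, Fintype.card_fin, fExp,
    nsmul_eq_mul, one_div, inv_pow, div_eq_mul_inv]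

lemma choose_two_le (k : ℕ) : (k.choose 2 : ℝ) ≤ k ^ 2 / 2 := by
  rw [Nat.cast_choose_two]
  have : (0 : ℝ) ≤ k := by positivity
  nlinarith

lemma fExp_eq (n k : ℕ) : fExp n k = n.choose k * (1 / 2) ^ k.choose 2 := by
  rw [fExp, one_div, inv_pow, div_eq_mul_inv]

open Finset in
lemma sum_inter_two_le {n k : ℕ} (hk : 3 ≤ k) (hkn : k ≤ n) :
    ∑ x ∈ (powersetCard k (univ : Finset (Fin n)) ×ˢ powersetCard k univ).filter
          (fun x => x.1 ≠ x.2 ∧ (x.1 ∩ x.2).card = 2),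
          (1 / 2 : ℝ) ^ (cliqueEdges x.1 ∪ cliqueEdges x.2).card ≤
      fExp n k ^ 2 * (k ^ 4 / n ^ 2) := by
  have hn : (0 : ℝ) < n := by exact_mod_cast (by omega : 0 < n)
  have hterm : ∀ x ∈ (powersetCard k (univ : Finset (Fin n)) ×ˢ powersetCard k univ).filter
      (fun x => x.1 ≠ x.2 ∧ (x.1 ∩ x.2).card = 2),
      (1 / 2 : ℝ) ^ (cliqueEdges x.1 ∪ cliqueEdges x.2).card =
        2 * ((1 / 2) ^ k.choose 2) ^ 2 := by
    rintro ⟨A, B⟩ hx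
    simp only [mem_filter, mem_product, mem_powersetCard_univ] at hx
    have h := card_cliqueEdges_union A B
    rw [hx.2.2, hx.1.1, hx.1.2, Nat.choose_self] at h
    have h2 : (1 / 2 : ℝ) ^ ((cliqueEdges A ∪ cliqueEdges B).card + 1) =
        (1 / 2) ^ (k.choose 2 + k.choose 2) := by rw [h]
    rw [pow_succ, pow_add] at h2
    simp only
    linarith
  rw [sum_congr rfl hterm, sum_const, nsmul_eq_mul]
  have hcard : ((((powersetCard k (univ : Finset (Fin n)) ×ˢ powersetCard k univ).filter
      (fun x => x.1 ≠ x.2 ∧ (x.1 ∩ x.2).card = 2)).card : ℕ) : ℝ) ≤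
      n.choose k * ((k ^ 2 / 2) * (n.choose k * ((k : ℝ) / n) ^ 2)) := by
    have h1 : ((powersetCard k (univ : Finset (Fin n)) ×ˢ powersetCard k univ).filter
        (fun x => x.1 ≠ x.2 ∧ (x.1 ∩ x.2).card = 2)).card ≤
        n.choose k * (k.choose 2 * (n - 2).choose (k - 2)) := by
      rw [card_filter, sum_product]
      have : ∀ A ∈ powersetCard k (univ : Finset (Fin n)),
          ∑ B ∈ powersetCard k (univ : Finset (Fin n)),
            (if A ≠ B ∧ (A ∩ B).card = 2 then 1 else 0) ≤
            k.choose 2 * (n - 2).choose (k - 2) := by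
        intro A hA
        have hAc := (mem_powersetCard.1 hA).2
        rw [← card_filter]
        have h := card_filter_inter_eq_le (k := k) (i := 2) (by omega) A
        rw [hAc] at h
        refine le_trans (card_le_card ?_) h
        exact monotone_filter_right _ fun B _ hB => hB.2
      have h := sum_le_card_nsmul _ _ _ this
      simpa using h
    calc _ ≤ ((n.choose k * (k.choose 2 * (n - 2).choose (k - 2)) : ℕ) : ℝ) := by
          exact_mod_cast h1
      _ ≤ _ := by
        push_cast
        gcongr
        · exact choose_two_le k
        · exact choose_sub_le (by omega) hkn (by omega)
  calc _ ≤ (n.choose k * ((k ^ 2 / 2) * (n.choose k * ((k : ℝ) / n) ^ 2))) *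
        (2 * ((1 / 2) ^ k.choose 2) ^ 2) := by gcongr
    _ = _ := by
      rw [fExp_eq]
      field_simp

open Finset in
lemma sum_inter_two_triple_le {n k : ℕ} (hk : 3 ≤ k) (hkn : 8 * k ^ 4 ≤ n) :
    ∑ x ∈ (powersetCard k (univ : Finset (Fin n)) ×ˢ powersetCard k univ ×ˢ
          powersetCard k univ).filter
          (fun x => (x.1 ≠ x.2.1 ∧ (x.1 ∩ x.2.1).card = 2) ∧
            (x.2.1 ≠ x.2.2 ∧ (x.2.1 ∩ x.2.2).card = 2) ∧
            (x.1 ≠ x.2.2 ∧ (x.1 ∩ x.2.2).card = 2)),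
          (1 / 2 : ℝ) ^ (cliqueEdges x.1 ∪ cliqueEdges x.2.1 ∪ cliqueEdges x.2.2).card ≤
      8 * fExp n k ^ 3 * (k ^ 6 / n ^ 4) := by
  have hkn' : k ≤ n := by
    have : k ≤ k ^ 4 := Nat.le_self_pow (by norm_num) k
    omega
  have hn : (0 : ℝ) < n := by exact_mod_cast (by omega : 0 < n)
  set F := (powersetCard k (univ : Finset (Fin n)) ×ˢ powersetCard k univ ×ˢ
          powersetCard k univ).filter
          (fun x => (x.1 ≠ x.2.1 ∧ (x.1 ∩ x.2.1).card = 2) ∧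
            (x.2.1 ≠ x.2.2 ∧ (x.2.1 ∩ x.2.2).card = 2) ∧
            (x.1 ≠ x.2.2 ∧ (x.1 ∩ x.2.2).card = 2)) with hF
  have hterm : ∀ x ∈ F,
      (1 / 2 : ℝ) ^ (cliqueEdges x.1 ∪ cliqueEdges x.2.1 ∪ cliqueEdges x.2.2).card ≤
        8 * ((1 / 2) ^ k.choose 2) ^ 3 := by
    rintro ⟨A, B, C⟩ hx
    simp only [hF, mem_filter, mem_product, mem_powersetCard_univ] at hx
    have h := card_cliqueEdges_union_three A B C
    rw [hx.2.1.2, hx.2.2.1.2, hx.2.2.2.2, hx.1.1, hx.1.2.1, hx.1.2.2, Nat.choose_self] at h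
    have h2 : (1 / 2 : ℝ) ^ ((cliqueEdges A ∪ cliqueEdges B ∪ cliqueEdges C).card + 3) ≤
        (1 / 2) ^ (k.choose 2 * 3) :=
      pow_le_pow_of_le_one (by norm_num) (by norm_num) (by omega)
    rw [pow_add, pow_mul] at h2
    simp only
    linarith
  have hcard : (F.card : ℝ) ≤ n.choose k * (((k ^ 2 / 2) * (n.choose k * ((k : ℝ) / n) ^ 2)) *
      (n.choose k * ((k : ℝ) / n) ^ 2 + (2 * k) ^ 3 * (n.choose k * ((k : ℝ) / n) ^ 3))) := by
    have h1 : F.card ≤ n.choose k * ((k.choose 2 * (n - 2).choose (k - 2)) *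
        ((n - 2).choose (k - 2) + (2 * k) ^ 3 * (n - 3).choose (k - 3))) := by
      set c := (n - 2).choose (k - 2) + (2 * k) ^ 3 * (n - 3).choose (k - 3) with hc
      rw [hF, card_filter, sum_product]
      have : ∀ A ∈ powersetCard k (univ : Finset (Fin n)),
          ∑ y ∈ powersetCard k (univ : Finset (Fin n)) ×ˢ powersetCard k univ,
            (if (A ≠ y.1 ∧ (A ∩ y.1).card = 2) ∧ (y.1 ≠ y.2 ∧ (y.1 ∩ y.2).card = 2) ∧
              (A ≠ y.2 ∧ (A ∩ y.2).card = 2) then 1 else 0) ≤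
            (k.choose 2 * (n - 2).choose (k - 2)) * c := by
        intro A hA
        have hAc := (mem_powersetCard.1 hA).2
        rw [sum_product]
        have hB : ∀ B ∈ powersetCard k (univ : Finset (Fin n)),
            ∑ C ∈ powersetCard k (univ : Finset (Fin n)),
              (if (A ≠ B ∧ (A ∩ B).card = 2) ∧ (B ≠ C ∧ (B ∩ C).card = 2) ∧
                (A ≠ C ∧ (A ∩ C).card = 2) then 1 else 0) ≤
            if (A ∩ B).card = 2 then c else 0 := by
          intro B hB
          have hBc := (mem_powersetCard.1 hB).2
          rw [← card_filter]
          split_ifs with hAB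
          · refine le_trans (card_le_card ?_) (card_filter_inter_two_two_le hk A B hAc hBc hAB)
            exact monotone_filter_right _ fun C _ hC => ⟨hC.2.1.2, hC.2.2.2⟩
          · rw [Nat.le_zero, card_eq_zero, filter_eq_empty_iff]
            exact fun C _ hC => hAB hC.1.2
        refine (sum_le_sum hB).trans ?_
        rw [← sum_filter, sum_const, smul_eq_mul]
        have h := card_filter_inter_eq_le (k := k) (i := 2) (by omega) A
        rw [hAc] at h
        exact Nat.mul_le_mul_right _ h
      have h := sum_le_card_nsmul _ _ _ this
      simpa using h
    calc _ ≤ ((n.choose k * ((k.choose 2 * (n - 2).choose (k - 2)) *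
        ((n - 2).choose (k - 2) + (2 * k) ^ 3 * (n - 3).choose (k - 3))) : ℕ) : ℝ) := by
          exact_mod_cast h1
      _ ≤ _ := by
        push_cast
        gcongr
        · exact choose_two_le k
        · exact choose_sub_le (by omega) hkn' (by omega)
        · exact choose_sub_le (by omega) hkn' (by omega)
        · exact choose_sub_le (by omega) hkn' (by omega)
  have hlast : n.choose k * ((k : ℝ) / n) ^ 2 + (2 * k) ^ 3 * (n.choose k * ((k : ℝ) / n) ^ 3) ≤
      2 * (n.choose k * ((k : ℝ) / n) ^ 2) := by
    have hkn'' : 8 * (k : ℝ) ^ 4 ≤ n := by exact_mod_cast hkn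
    have h1 : 8 * (k : ℝ) ^ 4 / n ≤ 1 := (div_le_one hn).2 hkn''
    have h2 : (2 * (k : ℝ)) ^ 3 * (n.choose k * ((k : ℝ) / n) ^ 3) =
        (8 * (k : ℝ) ^ 4 / n) * (n.choose k * ((k : ℝ) / n) ^ 2) := by
      field_simp
      ring
    have h3 : (0 : ℝ) ≤ n.choose k * ((k : ℝ) / n) ^ 2 := by positivity
    rw [h2]
    nlinarith
  calc _ ≤ F.card • (8 * ((1 / 2 : ℝ) ^ k.choose 2) ^ 3) := sum_le_card_nsmul _ _ _ hterm
    _ ≤ (n.choose k * (((k ^ 2 / 2) * (n.choose k * ((k : ℝ) / n) ^ 2)) *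
      (2 * (n.choose k * ((k : ℝ) / n) ^ 2)))) * (8 * ((1 / 2) ^ k.choose 2) ^ 3) := by
        rw [nsmul_eq_mul]
        refine mul_le_mul_of_nonneg_right (hcard.trans ?_) (by positivity)
        gcongr
    _ = _ := by
      rw [fExp_eq]
      field_simp

open Finset in
lemma sum_three_le_inter_le {n k : ℕ} (hkn : k ≤ n) :
    ∑ x ∈ (powersetCard k (univ : Finset (Fin n)) ×ˢ powersetCard k univ).filter
          (fun x => x.1 ≠ x.2 ∧ 3 ≤ (x.1 ∩ x.2).card),
          (1 / 2 : ℝ) ^ (cliqueEdges x.1 ∪ cliqueEdges x.2).card ≤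
      fExp n k ^ 2 * ∑ i ∈ Ico 3 k, (k.choose i : ℝ) ^ 2 / fExp n i := by
  set M := powersetCard k (univ : Finset (Fin n)) with hM
  set q := (1 / 2 : ℝ) ^ k.choose 2 with hq
  have hA : ∀ A ∈ M, ∑ B ∈ M.filter (fun B => A ≠ B ∧ 3 ≤ (A ∩ B).card),
      (1 / 2 : ℝ) ^ (cliqueEdges A ∪ cliqueEdges B).card ≤
      n.choose k * q ^ 2 * ∑ i ∈ Ico 3 k, (k.choose i : ℝ) ^ 2 / fExp n i := by
    intro A hA
    have hAc := (mem_powersetCard.1 hA).2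
    have hmaps : ∀ B ∈ M.filter (fun B => A ≠ B ∧ 3 ≤ (A ∩ B).card), (A ∩ B).card ∈ Ico 3 k := by
      intro B hB
      rw [mem_filter] at hB
      have hBc := (mem_powersetCard.1 hB.1).2
      rw [mem_Ico]
      refine ⟨hB.2.2, ?_⟩
      by_contra! hcon
      have h1 : A ∩ B = A := eq_of_subset_of_card_le inter_subset_left (by omega)
      have h2 : A ∩ B = B := eq_of_subset_of_card_le inter_subset_right (by omega)
      exact hB.2.1 (h1.symm.trans h2)
    rw [← sum_fiberwise_of_maps_to hmaps, mul_sum]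
    refine sum_le_sum fun i hi => ?_
    rw [mem_Ico] at hi
    have hterm : ∀ B ∈ (M.filter (fun B => A ≠ B ∧ 3 ≤ (A ∩ B).card)).filter
        (fun B => (A ∩ B).card = i),
        (1 / 2 : ℝ) ^ (cliqueEdges A ∪ cliqueEdges B).card = q ^ 2 * 2 ^ i.choose 2 := by
      intro B hB
      rw [mem_filter, mem_filter] at hB
      have hBc := (mem_powersetCard.1 hB.1.1).2
      have h := card_cliqueEdges_union A B
      rw [hB.2, hAc, hBc] at h
      have h2 : (1 / 2 : ℝ) ^ ((cliqueEdges A ∪ cliqueEdges B).card + i.choose 2) =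
          q ^ 2 := by rw [h, hq]; ring
      rw [← h2, pow_add, mul_assoc, ← mul_pow]
      norm_num
    rw [sum_congr rfl hterm, sum_const, nsmul_eq_mul]
    have hc : ((((M.filter (fun B => A ≠ B ∧ 3 ≤ (A ∩ B).card)).filter
        (fun B => (A ∩ B).card = i)).card : ℕ) : ℝ) ≤
        k.choose i * (n.choose k * k.choose i / n.choose i) := by
      rw [← choose_sub_eq hi.2.le hkn]
      have h := card_filter_inter_eq_le (k := k) (i := i) hi.2.le A
      rw [hAc] at h
      have h2 : ((M.filter (fun B => A ≠ B ∧ 3 ≤ (A ∩ B).card)).filter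
        (fun B => (A ∩ B).card = i)).card ≤ k.choose i * (n - i).choose (k - i) :=
        (card_le_card (filter_subset_filter _ (filter_subset _ _))).trans h
      exact_mod_cast h2
    have hpos : (0 : ℝ) < n.choose i := by
      exact_mod_cast Nat.choose_pos (hi.2.le.trans hkn)
    calc _ ≤ (k.choose i * (n.choose k * k.choose i / n.choose i)) * (q ^ 2 * 2 ^ i.choose 2) := by
          gcongr
      _ = _ := by
        rw [fExp]
        field_simp
  rw [sum_filter, sum_product]
  simp only [← sum_filter]
  refine (sum_le_card_nsmul _ _ _ hA).trans (le_of_eq ?_)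
  rw [hM, card_powersetCard, card_univ, Fintype.card_fin, nsmul_eq_mul, fExp_eq]
  ring

theorem expNu_ge {n k : ℕ} (hk : 3 ≤ k) (hkn : 8 * k ^ 4 ≤ n)
    (hf : (n : ℝ) ^ 2 ≤ fExp n k)
    (hsum : ∑ i ∈ Finset.Ico 3 k, (k.choose i : ℝ) ^ 2 / fExp n i ≤ 1 / n ^ 2) :
    1 / 256 * ((n : ℝ) ^ 2 / k ^ 4) * Real.log k ≤ expNu n k := by
  have hkn' : k ≤ n := by
    have : k ≤ k ^ 4 := Nat.le_self_pow (by norm_num) k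
    omega
  have hn : (0 : ℝ) < n := by exact_mod_cast (by omega : 0 < n)
  have hk3 : (3 : ℝ) ≤ k := by exact_mod_cast hk
  set μ := fExp n k with hμ
  have hμ0 : 0 < μ := lt_of_lt_of_le (by positivity) hf
  set t := (n : ℝ) ^ 2 / (8 * k ^ 3) with ht
  have ht0 : 0 < t := by positivity
  have hk27 : (27 : ℝ) ≤ k ^ 3 := by
    calc (27 : ℝ) = 3 ^ 3 := by norm_num
      _ ≤ k ^ 3 := by gcongr
  have htμ : t ≤ μ := by
    refine le_trans ?_ hf
    exact div_le_self (by positivity) (by linarith)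
  have h := le_expNu n k k (by omega) (t / μ) (by positivity) ((div_le_one hμ0).2 htμ)
  rw [sum_clique_prob] at h
  have hQ := (sum_three_le_inter_le hkn').trans (mul_le_mul_of_nonneg_left hsum (sq_nonneg _))
  have hT := sum_inter_two_triple_le hk hkn
  have hR := sum_inter_two_le hk hkn'
  set SQ := ∑ x ∈ (Finset.powersetCard k (Finset.univ : Finset (Fin n)) ×ˢ
      Finset.powersetCard k Finset.univ).filter (fun x => x.1 ≠ x.2 ∧ 3 ≤ (x.1 ∩ x.2).card),
          (1 / 2 : ℝ) ^ (cliqueEdges x.1 ∪ cliqueEdges x.2).card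
  set ST := ∑ x ∈ (Finset.powersetCard k (Finset.univ : Finset (Fin n)) ×ˢ
      Finset.powersetCard k Finset.univ ×ˢ Finset.powersetCard k Finset.univ).filter
          (fun x => (x.1 ≠ x.2.1 ∧ (x.1 ∩ x.2.1).card = 2) ∧
            (x.2.1 ≠ x.2.2 ∧ (x.2.1 ∩ x.2.2).card = 2) ∧
            (x.1 ≠ x.2.2 ∧ (x.1 ∩ x.2.2).card = 2)),
          (1 / 2 : ℝ) ^ (cliqueEdges x.1 ∪ cliqueEdges x.2.1 ∪ cliqueEdges x.2.2).card
  set SR := ∑ x ∈ (Finset.powersetCard k (Finset.univ : Finset (Fin n)) ×ˢ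
      Finset.powersetCard k Finset.univ).filter (fun x => x.1 ≠ x.2 ∧ (x.1 ∩ x.2).card = 2),
          (1 / 2 : ℝ) ^ (cliqueEdges x.1 ∪ cliqueEdges x.2).card
  have hQ' : (t / μ) ^ 2 * SQ ≤ t / 8 := by
    calc (t / μ) ^ 2 * SQ ≤ (t / μ) ^ 2 * (μ ^ 2 * (1 / n ^ 2)) := by gcongr
      _ = t * (1 / (8 * k ^ 3)) := by rw [ht]; field_simp
      _ ≤ t * (1 / 8) := by
        gcongr
        linarith
      _ = t / 8 := by ring
  have hT' : (t / μ) ^ 3 * ST ≤ t / 8 := by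
    calc (t / μ) ^ 3 * ST ≤ (t / μ) ^ 3 * (8 * μ ^ 3 * (k ^ 6 / n ^ 4)) := by gcongr
      _ = t / 8 := by rw [ht]; field_simp
  have hR' : (t / μ) ^ 2 * SR / k ≤ t / 8 := by
    calc (t / μ) ^ 2 * SR / k ≤ (t / μ) ^ 2 * (μ ^ 2 * (k ^ 4 / n ^ 2)) / k := by gcongr
      _ = t / 8 := by rw [ht]; field_simp
  have hlog : 0 ≤ Real.log k := Real.log_nonneg (by linarith)
  have hfin : Real.log k * (t / 2) ≤ 16 * k * expNu n k := by
    refine le_trans (mul_le_mul_of_nonneg_left ?_ hlog) h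
    rw [div_mul_cancel₀ _ hμ0.ne']
    linarith
  have : 1 / 256 * ((n : ℝ) ^ 2 / k ^ 4) * Real.log k = Real.log k * (t / 2) / (16 * k) := by
    rw [ht]
    field_simp
    ring
  rw [this, div_le_iff₀ (by positivity)]
  linarith

lemma fExp_succ_mul_le (n i : ℕ) : fExp n (i + 1) * 2 ^ i ≤ fExp n i * n := by
  have h1 : n.choose (i + 1) ≤ n.choose i * n := by
    calc n.choose (i + 1) ≤ n.choose (i + 1) * (i + 1) := Nat.le_mul_of_pos_right _ i.succ_pos
      _ = n.choose i * (n - i) := Nat.choose_succ_right_eq n i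
      _ ≤ n.choose i * n := Nat.mul_le_mul_left _ (Nat.sub_le _ _)
  have h2 : (i + 1).choose 2 = i.choose 2 + i := by
    rw [Nat.choose_succ_succ' i 1, Nat.choose_one_right, add_comm]
  have h1' : (n.choose (i + 1) : ℝ) ≤ n.choose i * n := by exact_mod_cast h1
  rw [fExp, fExp, h2, pow_add, div_mul_eq_mul_div, div_mul_eq_mul_div,
    div_le_div_iff₀ (by positivity) (by positivity)]
  calc (n.choose (i + 1) : ℝ) * 2 ^ i * 2 ^ i.choose 2
      ≤ (n.choose i * n) * 2 ^ i * 2 ^ i.choose 2 := by gcongr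
    _ = _ := by ring

lemma fExp_two_mul_log_lt_one (n : ℕ) : fExp n (2 * Nat.log 2 n + 3) < 1 := by
  set L := Nat.log 2 n with hL
  have hn : n < 2 ^ (L + 1) := Nat.lt_pow_succ_log_self (by norm_num) n
  have h1 : (2 * L + 3).choose 2 = (L + 1) * (2 * L + 3) := by
    rw [Nat.choose_two_right, show 2 * L + 3 - 1 = 2 * (L + 1) by omega,
      show (2 * L + 3) * (2 * (L + 1)) = ((L + 1) * (2 * L + 3)) * 2 by ring,
      Nat.mul_div_cancel _ (by norm_num)]
  rw [fExp, div_lt_one (by positivity), h1, pow_mul]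
  have h2 : n.choose (2 * L + 3) < (2 ^ (L + 1)) ^ (2 * L + 3) :=
    (Nat.choose_le_pow _ _).trans_lt (Nat.pow_lt_pow_left hn (by omega))
  exact_mod_cast h2

lemma kZero_le (n : ℕ) : kZero n ≤ 2 * Nat.log 2 n + 3 :=
  Nat.sInf_le (fExp_two_mul_log_lt_one n)

lemma fExp_kZero_lt_one (n : ℕ) : fExp n (kZero n) < 1 :=
  Nat.sInf_mem (s := {k | fExp n k < 1}) ⟨_, fExp_two_mul_log_lt_one n⟩

lemma one_le_fExp_of_lt {n j : ℕ} (h : j < kZero n) : 1 ≤ fExp n j :=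
  not_lt.1 (Nat.notMem_of_lt_sInf h)

lemma two_pow_choose_two_sq (j : ℕ) : (2 ^ j.choose 2) ^ 2 = (2 ^ (j - 1)) ^ j := by
  rw [← pow_mul, ← pow_mul, Nat.choose_two_right,
    Nat.div_mul_cancel (Nat.even_mul_pred_self j).two_dvd, mul_comm]

lemma sq_lt_of_fExp_lt_one {n j : ℕ} (hjn : j ≤ n) (h : fExp n j < 1) :
    n ^ 2 < j ^ 2 * 2 ^ (j - 1) := by
  rw [fExp, div_lt_one (by positivity)] at h
  have h' : n.choose j < 2 ^ j.choose 2 := by exact_mod_cast h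
  have h1 := choose_mul_pow_le hjn j
  rw [Nat.choose_self, one_mul] at h1
  rcases Nat.eq_zero_or_pos j with rfl | hj
  · simp at h'
  have h2 : n ^ j < 2 ^ j.choose 2 * j ^ j :=
    h1.trans_lt (Nat.mul_lt_mul_of_pos_right h' (by positivity))
  have h3 : (n ^ j) ^ 2 < (2 ^ j.choose 2 * j ^ j) ^ 2 := Nat.pow_lt_pow_left h2 (by norm_num)
  rw [mul_pow, two_pow_choose_two_sq] at h3
  refine lt_of_pow_lt_pow_left₀ j (by positivity) ?_
  calc (n ^ 2) ^ j = (n ^ j) ^ 2 := by ring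
    _ < _ := h3
    _ = _ := by ring

/-- `f_n(k₀ - 4)` is at least of order `n³ / k₀⁶`. -/
lemma pow_three_le_fExp_kZero_sub {n : ℕ} (hn : 0 < n) (h4 : 4 ≤ kZero n) (hKn : kZero n ≤ n) :
    (n : ℝ) ^ 3 ≤ 512 * kZero n ^ 6 * fExp n (kZero n - 4) := by
  obtain ⟨k, hk⟩ : ∃ k, kZero n = k + 4 := ⟨kZero n - 4, by omega⟩
  have h1 := sq_lt_of_fExp_lt_one hKn (fExp_kZero_lt_one n)
  have hf : 1 ≤ fExp n (k + 3) := one_le_fExp_of_lt (by omega)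
  set K := kZero n with hKdef
  have hn' : (0 : ℝ) < n := by exact_mod_cast hn
  rw [show K - 1 = k + 3 by omega] at h1
  rw [show K - 4 = k by omega]
  have h1' : (n : ℝ) ^ 2 ≤ 8 * K ^ 2 * 2 ^ k := by
    have : (n : ℝ) ^ 2 < K ^ 2 * 2 ^ (k + 3) := by exact_mod_cast h1
    rw [pow_add] at this
    linarith
  have a1 := fExp_succ_mul_le n k
  have a2 := fExp_succ_mul_le n (k + 1)
  have a3 := fExp_succ_mul_le n (k + 2)
  have hp : (0 : ℝ) < 2 ^ k := by positivity
  have hlow : ((2 : ℝ) ^ k) ^ 3 ≤ fExp n k * n ^ 3 := by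
    have b3 : (2 : ℝ) ^ k ≤ fExp n (k + 2) * n := by
      refine le_trans ?_ a3
      have : (2 : ℝ) ^ k ≤ 2 ^ (k + 2) := pow_le_pow_right₀ (by norm_num) (by omega)
      nlinarith
    have b2 : (2 : ℝ) ^ k * 2 ^ k ≤ fExp n (k + 1) * n * n := by
      calc (2 : ℝ) ^ k * 2 ^ k ≤ (fExp n (k + 2) * n) * 2 ^ (k + 1) := by
            have : (2 : ℝ) ^ k ≤ 2 ^ (k + 1) := pow_le_pow_right₀ (by norm_num) (by omega)
            exact mul_le_mul b3 this hp.le (hp.le.trans b3)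
        _ = (fExp n (k + 1 + 1) * 2 ^ (k + 1)) * n := by ring
        _ ≤ _ := by gcongr
    calc ((2 : ℝ) ^ k) ^ 3 = (2 ^ k * 2 ^ k) * 2 ^ k := by ring
      _ ≤ (fExp n (k + 1) * n * n) * 2 ^ k := by gcongr
      _ = (fExp n (k + 1) * 2 ^ k) * n ^ 2 := by ring
      _ ≤ (fExp n k * n) * n ^ 2 := by gcongr
      _ = _ := by ring
  have hcube : ((n : ℝ) ^ 2) ^ 3 ≤ (8 * K ^ 2 * 2 ^ k) ^ 3 := by gcongr
  have : (n : ℝ) ^ 3 * n ^ 3 ≤ (512 * K ^ 6 * fExp n k) * n ^ 3 := by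
    calc (n : ℝ) ^ 3 * n ^ 3 = (n ^ 2) ^ 3 := by ring
      _ ≤ _ := hcube
      _ = 512 * K ^ 6 * (2 ^ k) ^ 3 := by ring
      _ ≤ 512 * K ^ 6 * (fExp n k * n ^ 3) := by gcongr
      _ = _ := by ring
  exact le_of_mul_le_mul_right this (by positivity)

lemma choose_sq_div_fExp_le {n k i : ℕ} (hik : i ≤ k) (hkn : k ≤ n) (hn : 0 < n) :
    (k.choose i : ℝ) ^ 2 / fExp n i ≤ ((k : ℝ) ^ 2 / n) ^ i * 2 ^ i.choose 2 := by
  have h : (0 : ℝ) < n.choose i := by exact_mod_cast Nat.choose_pos (hik.trans hkn)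
  have hn' : (0 : ℝ) < n := by exact_mod_cast hn
  have h1 : (k.choose i : ℝ) / n.choose i ≤ ((k : ℝ) / n) ^ i := by
    rw [div_pow, div_le_div_iff₀ h (by positivity), mul_comm ((k : ℝ) ^ i)]
    exact_mod_cast choose_mul_pow_le hkn i
  have h2 : (k.choose i : ℝ) ≤ (k : ℝ) ^ i := by exact_mod_cast Nat.choose_le_pow k i
  calc (k.choose i : ℝ) ^ 2 / fExp n i
      = k.choose i * (k.choose i / n.choose i) * 2 ^ i.choose 2 := by
        rw [fExp]; field_simp
    _ ≤ (k : ℝ) ^ i * ((k : ℝ) / n) ^ i * 2 ^ i.choose 2 := by gcongr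
    _ = _ := by rw [← mul_pow]; ring

lemma choose_sq_div_fExp_le_inv {n k i : ℕ} (hik : i ≤ k) (hkn : k ≤ n) (x : ℝ)
    (hx : x ^ 4 = n) (hx0 : 0 < x) (hkx : (k : ℝ) ^ 2 ≤ x) (hx1 : 1 ≤ x)
    (hi : x ^ 6 ≤ 2 ^ i) :
    (k.choose i : ℝ) ^ 2 / fExp n i ≤ 1 / fExp n k := by
  have hpos : ∀ j ≤ n, 0 < fExp n j := fun j hj => by
    have : (0 : ℝ) < n.choose j := by exact_mod_cast Nat.choose_pos hj
    rw [fExp]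
    positivity
  have hstep : ∀ j, i ≤ j → fExp n j * (x ^ 2) ^ (j - i) ≤ fExp n i := by
    intro j hij
    induction j, hij using Nat.le_induction with
    | base => simp
    | succ j hij ih =>
      refine le_trans ?_ ih
      have h1 := fExp_succ_mul_le n j
      have h2 : x ^ 6 ≤ 2 ^ j := hi.trans (pow_le_pow_right₀ (by norm_num) hij)
      have h0 : 0 ≤ fExp n (j + 1) := by rw [fExp]; positivity
      have h3 : fExp n (j + 1) * x ^ 2 ≤ fExp n j := by
        have : fExp n (j + 1) * x ^ 2 * x ^ 4 ≤ fExp n j * x ^ 4 := by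
          calc fExp n (j + 1) * x ^ 2 * x ^ 4 = fExp n (j + 1) * x ^ 6 := by ring
            _ ≤ fExp n (j + 1) * 2 ^ j := by gcongr
            _ ≤ fExp n j * n := h1
            _ = _ := by rw [hx]
        exact le_of_mul_le_mul_right this (by positivity)
      rw [show j + 1 - i = (j - i) + 1 by omega, pow_succ]
      calc fExp n (j + 1) * ((x ^ 2) ^ (j - i) * x ^ 2)
          = (fExp n (j + 1) * x ^ 2) * (x ^ 2) ^ (j - i) := by ring
        _ ≤ _ := by gcongr
  have hk := hstep k hik
  have hc : (k.choose i : ℝ) ^ 2 ≤ (x ^ 2) ^ (k - i) := by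
    rw [← Nat.choose_symm hik]
    have h2 : (k.choose (k - i) : ℝ) ≤ (k : ℝ) ^ (k - i) := by
      exact_mod_cast Nat.choose_le_pow k (k - i)
    calc (k.choose (k - i) : ℝ) ^ 2 ≤ ((k : ℝ) ^ (k - i)) ^ 2 := by gcongr
      _ = ((k : ℝ) ^ 2) ^ (k - i) := by ring
      _ ≤ (x ^ 2) ^ (k - i) := by
        gcongr
        nlinarith
  rw [div_le_div_iff₀ (hpos i (hik.trans hkn)) (hpos k hkn), one_mul]
  calc (k.choose i : ℝ) ^ 2 * fExp n k ≤ (x ^ 2) ^ (k - i) * fExp n k := by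
        have := (hpos k hkn).le
        gcongr
    _ ≤ _ := by rw [mul_comm]; exact hk

lemma sum_choose_sq_div_fExp_le {n k K : ℕ} (hkK : k ≤ K) (hk : 3 ≤ k)
    (hn : 2 ^ 66 * K ^ 25 ≤ n) (hf : (n : ℝ) ^ 3 ≤ 512 * K ^ 6 * fExp n k) :
    ∑ i ∈ Finset.Ico 3 k, (k.choose i : ℝ) ^ 2 / fExp n i ≤ 1 / n ^ 2 := by
  have hK1 : (1 : ℝ) ≤ K := by exact_mod_cast (by omega : 1 ≤ K)
  have hk0 : (0 : ℝ) < k := by exact_mod_cast (by omega : 0 < k)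
  have hkKR : (k : ℝ) ≤ K := by exact_mod_cast hkK
  have hnR : (2 : ℝ) ^ 66 * K ^ 25 ≤ n := by exact_mod_cast hn
  have hKn : ∀ m ≤ 25, (2 : ℝ) ^ 66 * K ^ m ≤ n := fun m hm => by
    refine le_trans ?_ hnR
    gcongr
  have hn1 : (1 : ℝ) ≤ n := by
    have h := hKn 0 (by norm_num)
    rw [pow_zero, mul_one] at h
    exact le_trans (by norm_num) h
  have hn0 : (0 : ℝ) < n := by linarith
  have hnN : 0 < n := by exact_mod_cast hn0
  have hkn : k ≤ n := by
    have h := hKn 1 (by norm_num)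
    have : (k : ℝ) ≤ n := by
      rw [pow_one] at h
      linarith
    exact_mod_cast this
  set x := Real.sqrt (Real.sqrt n) with hxdef
  have hx4 : x ^ 4 = n := by
    rw [show x ^ 4 = (x ^ 2) ^ 2 by ring, hxdef, Real.sq_sqrt (Real.sqrt_nonneg _),
      Real.sq_sqrt hn0.le]
  have hx1 : 1 ≤ x := Real.one_le_sqrt.2 (Real.one_le_sqrt.2 hn1)
  have hx0 : 0 < x := by linarith
  have hkx : (k : ℝ) ^ 2 ≤ x := by
    refine le_of_pow_le_pow_left₀ (n := 4) (by norm_num) hx0.le ?_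
    rw [hx4]
    calc ((k : ℝ) ^ 2) ^ 4 = (k : ℝ) ^ 8 := by ring
      _ ≤ (K : ℝ) ^ 8 := by gcongr
      _ ≤ 2 ^ 66 * (K : ℝ) ^ 8 := le_mul_of_one_le_left (by positivity) (by norm_num)
      _ ≤ (n : ℝ) := hKn 8 (by norm_num)
  have hterm : ∀ i ∈ Finset.Ico 3 k,
      (k.choose i : ℝ) ^ 2 / fExp n i ≤ 1 / (k * n ^ 2) := by
    intro i hi
    rw [Finset.mem_Ico] at hi
    rcases le_or_gt (x ^ 6) (2 ^ i) with hxi | hxi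
    · refine (choose_sq_div_fExp_le_inv hi.2.le hkn x hx4 hx0 hkx hx1 hxi).trans ?_
      have hfpos : 0 < fExp n k := by
        by_contra! hneg
        have h1 : (0 : ℝ) < n ^ 3 := by positivity
        have h2 : 512 * (K : ℝ) ^ 6 * fExp n k ≤ 0 :=
          mul_nonpos_of_nonneg_of_nonpos (by positivity) hneg
        linarith
      gcongr
      have h7 : 512 * (K : ℝ) ^ 7 ≤ n := by
        refine le_trans ?_ (hKn 7 (by norm_num))
        gcongr
        norm_num
      have : 512 * (K : ℝ) ^ 6 * (k * n ^ 2) ≤ 512 * K ^ 6 * fExp n k := by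
        refine le_trans ?_ hf
        calc 512 * (K : ℝ) ^ 6 * (k * n ^ 2) ≤ 512 * (K : ℝ) ^ 6 * (K * n ^ 2) := by gcongr
          _ = (512 * (K : ℝ) ^ 7) * (n : ℝ) ^ 2 := by ring
          _ ≤ (n : ℝ) * (n : ℝ) ^ 2 := by gcongr
          _ = _ := by ring
      exact le_of_mul_le_mul_left this (by positivity)
    · refine (choose_sq_div_fExp_le hi.2.le hkn hnN).trans ?_
      rcases lt_or_ge i 12 with h12 | h12
      · have hle1 : (k : ℝ) ^ 2 / n ≤ 1 := by
          rw [div_le_one hn0]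
          calc (k : ℝ) ^ 2 ≤ (K : ℝ) ^ 2 := by gcongr
            _ ≤ 2 ^ 66 * (K : ℝ) ^ 2 := le_mul_of_one_le_left (by positivity) (by norm_num)
            _ ≤ (n : ℝ) := hKn 2 (by norm_num)
        have hch : i.choose 2 ≤ 66 := by
          calc i.choose 2 ≤ (12).choose 2 := Nat.choose_le_choose 2 h12.le
            _ = 66 := by decide
        calc ((k : ℝ) ^ 2 / n) ^ i * 2 ^ i.choose 2 ≤ ((k : ℝ) ^ 2 / n) ^ 3 * 2 ^ 66 := by
              gcongr ?_ * ?_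
              · exact pow_le_pow_of_le_one (by positivity) hle1 hi.1
              · exact pow_le_pow_right₀ (by norm_num) hch
          _ ≤ _ := by
            rw [div_pow, div_mul_eq_mul_div, div_le_div_iff₀ (by positivity) (by positivity)]
            calc ((k : ℝ) ^ 2) ^ 3 * 2 ^ 66 * (k * n ^ 2) = (2 ^ 66 * (k : ℝ) ^ 7) * (n : ℝ) ^ 2 := by ring
              _ ≤ (2 ^ 66 * (K : ℝ) ^ 7) * (n : ℝ) ^ 2 := by gcongr
              _ ≤ (n : ℝ) * (n : ℝ) ^ 2 := by
                gcongr
                exact hKn 7 (by norm_num)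
              _ = 1 * (n : ℝ) ^ 3 := by ring
      · have hpow : (2 : ℝ) ^ i.choose 2 ≤ (x ^ 3) ^ i := by
          refine le_of_pow_le_pow_left₀ (n := 2) (by norm_num) (by positivity) ?_
          have h2 : ((2 : ℝ) ^ i.choose 2) ^ 2 = (2 ^ (i - 1)) ^ i := by
            exact_mod_cast two_pow_choose_two_sq i
          rw [h2]
          calc ((2 : ℝ) ^ (i - 1)) ^ i ≤ (x ^ 6) ^ i := by
                gcongr
                exact le_trans (pow_le_pow_right₀ (by norm_num) (by omega)) hxi.le
            _ = ((x ^ 3) ^ i) ^ 2 := by ring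
        calc ((k : ℝ) ^ 2 / n) ^ i * 2 ^ i.choose 2 ≤ ((k : ℝ) ^ 2 / n) ^ i * (x ^ 3) ^ i := by
              gcongr
          _ = ((k : ℝ) ^ 2 / x) ^ i := by
            rw [← mul_pow, ← hx4]
            congr 1
            field_simp
          _ ≤ ((k : ℝ) ^ 2 / x) ^ 12 :=
            pow_le_pow_of_le_one (by positivity) ((div_le_one hx0).2 hkx) h12
          _ ≤ _ := by
            rw [div_pow, show x ^ 12 = (x ^ 4) ^ 3 by ring, hx4,
              div_le_div_iff₀ (by positivity) (by positivity)]
            calc ((k : ℝ) ^ 2) ^ 12 * (k * n ^ 2) = (k : ℝ) ^ 25 * (n : ℝ) ^ 2 := by ring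
              _ ≤ (K : ℝ) ^ 25 * (n : ℝ) ^ 2 := by gcongr
              _ ≤ (2 ^ 66 * (K : ℝ) ^ 25) * (n : ℝ) ^ 2 := by
                gcongr
                exact le_mul_of_one_le_left (by positivity) (by norm_num)
              _ ≤ (n : ℝ) * (n : ℝ) ^ 2 := by gcongr
              _ = 1 * (n : ℝ) ^ 3 := by ring
  calc ∑ i ∈ Finset.Ico 3 k, (k.choose i : ℝ) ^ 2 / fExp n i
      ≤ (Finset.Ico 3 k).card • (1 / (k * (n : ℝ) ^ 2)) :=
        Finset.sum_le_card_nsmul _ _ _ hterm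
    _ ≤ k * (1 / (k * (n : ℝ) ^ 2)) := by
      rw [nsmul_eq_mul, Nat.card_Ico]
      gcongr
      omega
    _ = 1 / (n : ℝ) ^ 2 := by field_simp

open Filter in
lemma eventually_kZero_pow_le : ∀ᶠ n : ℕ in atTop, 2 ^ 66 * kZero n ^ 25 ≤ n := by
  have h1 := (Real.isLittleO_pow_log_id_atTop (n := 25)).bound
    (show (0 : ℝ) < 1 / (2 ^ 66 * 7 ^ 25) by positivity)
  have h2 := tendsto_natCast_atTop_atTop (R := ℝ) |>.eventually h1
  have h3 := (Real.tendsto_log_atTop.comp (tendsto_natCast_atTop_atTop (R := ℝ))).eventually_ge_atTop 1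
  filter_upwards [h2, h3, eventually_ge_atTop 1] with n hn hlog hn1
  simp only [Function.comp_apply] at hlog
  have hn0 : (0 : ℝ) < n := by exact_mod_cast hn1
  rw [id, Real.norm_of_nonneg (by positivity), Real.norm_of_nonneg hn0.le] at hn
  have hL : (Nat.log 2 n : ℝ) ≤ 2 * Real.log n := by
    have ha : (2 : ℝ) ^ Nat.log 2 n ≤ n := by exact_mod_cast Nat.pow_log_le_self 2 (by omega)
    have hb := Real.log_le_log (by positivity) ha
    rw [Real.log_pow] at hb
    have hc := Real.log_two_gt_d9
    have hd : (0 : ℝ) ≤ Nat.log 2 n := by positivity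
    nlinarith
  have hK : (kZero n : ℝ) ≤ 7 * Real.log n := by
    have : (kZero n : ℝ) ≤ 2 * Nat.log 2 n + 3 := by exact_mod_cast kZero_le n
    linarith
  have : (2 : ℝ) ^ 66 * kZero n ^ 25 ≤ n := by
    calc (2 : ℝ) ^ 66 * kZero n ^ 25 ≤ 2 ^ 66 * (7 * Real.log n) ^ 25 := by gcongr
      _ = (2 ^ 66 * 7 ^ 25) * Real.log n ^ 25 := by rw [mul_pow, mul_assoc]
      _ ≤ (2 ^ 66 * 7 ^ 25) * (1 / (2 ^ 66 * 7 ^ 25) * n) := by gcongr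
      _ = n := by field_simp
  exact_mod_cast this

/-- There is `c > 0` such that for all large `n`, with `k = k₀(n) - 4`,
`E[ν_k(G_{n,1/2})] ≥ c · (n²/k⁴) · log k`. -/
theorem stmt1 :
    ∃ c : ℝ, 0 < c ∧ ∃ N : ℕ, ∀ n, N ≤ n →
      c * ((n : ℝ) ^ 2 / ((kZero n - 4 : ℕ) : ℝ) ^ 4) * Real.log ((kZero n - 4 : ℕ) : ℝ) ≤
        expNu n (kZero n - 4) := by
  obtain ⟨N, hN⟩ := Filter.eventually_atTop.1 eventually_kZero_pow_le
  refine ⟨1 / 256, by norm_num, max N 100, fun n hn => ?_⟩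
  have hK := hN n (le_of_max_le_left hn)
  have hn100 : 100 ≤ n := le_of_max_le_right hn
  have hpow : ∀ m, m ≤ 25 → m ≠ 0 → kZero n ^ m ≤ kZero n ^ 25 := fun m hm h0 => by
    rcases Nat.eq_zero_or_pos (kZero n) with h | h
    · rw [h, zero_pow h0, zero_pow (by norm_num)]
    · exact Nat.pow_le_pow_right h hm
  have hKn : kZero n ≤ n := by
    have := hpow 1 (by norm_num) (by norm_num)
    rw [pow_one] at this
    omega
  have h7 : 7 ≤ kZero n := by
    have h := sq_lt_of_fExp_lt_one hKn (fExp_kZero_lt_one n)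
    by_contra! hcon
    have h1 : kZero n ^ 2 * 2 ^ (kZero n - 1) ≤ 6 ^ 2 * 2 ^ 5 :=
      Nat.mul_le_mul (Nat.pow_le_pow_left (by omega) 2)
        (Nat.pow_le_pow_right (by norm_num) (by omega))
    have h2 : 100 ^ 2 ≤ n ^ 2 := Nat.pow_le_pow_left hn100 2
    omega
  have hn0 : (0 : ℝ) < n := by exact_mod_cast (by omega : 0 < n)
  have hf := pow_three_le_fExp_kZero_sub (by omega : 0 < n) (by omega) hKn
  refine expNu_ge (by omega) ?_ ?_
    (sum_choose_sq_div_fExp_le (Nat.sub_le _ _) (by omega) hK hf)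
  · have h1 : (kZero n - 4) ^ 4 ≤ kZero n ^ 4 := Nat.pow_le_pow_left (Nat.sub_le _ _) 4
    have h2 := hpow 4 (by norm_num) (by norm_num)
    omega
  · have h6 : 512 * (kZero n : ℝ) ^ 6 ≤ n := by
      have : 512 * kZero n ^ 6 ≤ n := by
        have := hpow 6 (by norm_num) (by norm_num)
        omega
      exact_mod_cast this
    have hK0 : (0 : ℝ) < 512 * (kZero n : ℝ) ^ 6 := by
      have : (0 : ℝ) < kZero n := by exact_mod_cast (by omega : 0 < kZero n)
      positivity
    have : 512 * (kZero n : ℝ) ^ 6 * n ^ 2 ≤ 512 * kZero n ^ 6 * fExp n (kZero n - 4) := by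
      refine le_trans ?_ hf
      calc 512 * (kZero n : ℝ) ^ 6 * n ^ 2 ≤ (n : ℝ) * (n : ℝ) ^ 2 := by gcongr
        _ = (n : ℝ) ^ 3 := by ring
    exact le_of_mul_le_mul_left this hK0
end

section
/- There exists β > 0 with the following property: for every d₀ > 0 there exist ε > 0 and N such that for all n ≥ N, all integers k with 1/ε ≤ k ≤ ε·√n, and all reals D ≥ d₀ for which t := D·n²/k³ is a positive integer, one has ζ(n,k,t) < exp(−β·D·t·k) if D ≤ e, and ζ(n,k,t) < exp(−β·(log D)·t·k) if D > e. -/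
/-- `zeta n k t` is the probability that `t` sets drawn uniformly and independently
from the `k`-element subsets of `{1,…,n}` form a packing (pairwise intersections of
size at most 1). -/
noncomputable def zeta (n k t : ℕ) : ℝ :=
  (Nat.card {A : Fin t → Finset (Fin n) //
      (∀ i, (A i).card = k) ∧ ∀ i j, i ≠ j → ((A i) ∩ (A j)).card ≤ 1} : ℝ) /
    ((n.choose k : ℝ) ^ t)

section IndependentSets

open scoped Classical
open Finset

variable {α : Type*}

/-- The independent subsets of `S` of size `m` in the graph `G`. -/
noncomputable def indepSets (G : SimpleGraph α) (S : Finset α) (m : ℕ) : Finset (Finset α) :=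
  {B ∈ S.powersetCard m | G.IsIndepSet (B : Set α)}

/-- The number of neighbours of `x` inside `S`. -/
noncomputable def degIn (G : SimpleGraph α) (S : Finset α) (x : α) : ℕ :=
  #{y ∈ S | G.Adj x y}

lemma succ_mul_card_indepSets_le [DecidableEq α] (G : SimpleGraph α) (S : Finset α) (m : ℕ) :
    (m + 1) * #(indepSets G S (m + 1)) ≤
      ∑ x ∈ S, #(indepSets G {y ∈ S | ¬ G.Adj x y} m) := by
  have hcount : ∑ B ∈ indepSets G S (m + 1), #B =
      ∑ x ∈ S, #{B ∈ indepSets G S (m + 1) | x ∈ B} := by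
    have h := sum_card_bipartiteAbove_eq_sum_card_bipartiteBelow
      (fun (x : α) (B : Finset α) => x ∈ B) (s := S) (t := indepSets G S (m + 1))
    simp only [bipartiteAbove, bipartiteBelow] at h
    rw [h]
    refine sum_congr rfl fun B hB => ?_
    simp only [indepSets, mem_filter, mem_powersetCard] at hB
    congr 1
    ext x
    simp only [mem_filter]
    exact ⟨fun hx => ⟨hB.1.1 hx, hx⟩, fun hx => hx.2⟩
  have hcard : ∑ B ∈ indepSets G S (m + 1), #B = (m + 1) * #(indepSets G S (m + 1)) := by
    rw [sum_const_nat (m := m + 1), mul_comm]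
    intro B hB
    simp only [indepSets, mem_filter, mem_powersetCard] at hB
    exact hB.1.2
  rw [← hcard, hcount]
  refine sum_le_sum fun x _ => card_le_card_of_injOn (fun B => B.erase x) ?_ ?_
  · intro B hB
    simp only [indepSets, mem_coe, mem_filter, mem_powersetCard] at hB ⊢
    obtain ⟨⟨⟨hBS, hBm⟩, hind⟩, hx⟩ := hB
    refine ⟨⟨fun y hy => ?_, by rw [card_erase_of_mem hx, hBm]; rfl⟩, ?_⟩
    · rw [mem_erase] at hy
      exact mem_filter.2 ⟨hBS hy.2, hind hx hy.2 hy.1.symm⟩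
    · exact hind.mono (by simp)
  · intro B hB C hC h
    simp only [mem_coe, mem_filter] at hB hC
    rw [← insert_erase hB.2, ← insert_erase hC.2]
    exact congrArg (insert x) h

lemma card_filter_not_adj (G : SimpleGraph α) (S : Finset α) (x : α) :
    (#{y ∈ S | ¬ G.Adj x y} : ℝ) = #S - degIn G S x := by
  have h := card_filter_add_card_filter_not (s := S) (fun y => G.Adj x y)
  rw [← h, degIn]
  push_cast
  ring

lemma factorial_mul_card_indepSets_le_pow (G : SimpleGraph α) (S : Finset α) (m : ℕ) :
    (m.factorial * #(indepSets G S m) : ℝ) ≤ (#S : ℝ) ^ m := by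
  have h1 : #(indepSets G S m) ≤ (#S).choose m :=
    (card_filter_le _ _).trans (card_powersetCard m S).le
  have h2 : m.factorial * #(indepSets G S m) ≤ (#S) ^ m :=
    (Nat.mul_le_mul_left _ h1).trans
      ((Nat.descFactorial_eq_factorial_mul_choose _ _).symm.le.trans
        (Nat.descFactorial_le_pow _ _))
  exact_mod_cast h2

lemma shrink_le_mul_exp {ρ s s₀ d : ℝ} (hρ : 0 < ρ) (hρ1 : ρ ≤ 1) (hs₀ : 0 ≤ s₀) (hs : s₀ < s)
    (hd : 0 ≤ d) :
    ρ * (s - d) + s₀ ≤ (ρ * s + s₀) * Real.exp (-(ρ * d / (2 * s))) := by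
  have hs' : 0 < s := hs₀.trans_lt hs
  have h1 : 1 - ρ * d / (2 * s) ≤ Real.exp (-(ρ * d / (2 * s))) := by
    have := Real.add_one_le_exp (-(ρ * d / (2 * s)))
    linarith
  have h2 : 0 < ρ * s + s₀ := by positivity
  refine le_trans ?_ (mul_le_mul_of_nonneg_left h1 h2.le)
  have h3 : (ρ * s + s₀) * (ρ * d / (2 * s)) ≤ ρ * d := by
    rw [mul_div_assoc', div_le_iff₀ (by positivity)]
    have : ρ * s + s₀ ≤ 2 * s := by nlinarith
    have h4 : 0 ≤ ρ * d := by positivity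
    nlinarith
  nlinarith

/-- If in every large subset of `W` a random vertex typically has many neighbours, then `W` has
few independent sets. -/
lemma factorial_mul_card_indepSets_le [DecidableEq α] (G : SimpleGraph α) (W : Finset α) {ρ s₀ : ℝ} (q : ℕ)
    (hρ : 0 < ρ) (hρ1 : ρ ≤ 1) (hs₀ : 0 ≤ s₀)
    (hW : ∀ S ⊆ W, s₀ ≤ #S →
      ∑ x ∈ S, Real.exp (-(ρ * degIn G S x / (2 * #S)) * q) ≤ ρ * #S)
    (m : ℕ) : ∀ S ⊆ W,
      ρ ^ q * (m.factorial * #(indepSets G S m)) ≤ (ρ * #S + s₀) ^ m := by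
  induction m with
  | zero =>
    intro S _
    have h := factorial_mul_card_indepSets_le_pow G S 0
    have h2 : ρ ^ q ≤ 1 := pow_le_one₀ hρ.le hρ1
    have h3 : (0 : ℝ) < ρ ^ q := by positivity
    simp only [pow_zero] at h ⊢
    nlinarith
  | succ m ih =>
    intro S hS
    have htriv := factorial_mul_card_indepSets_le_pow G S (m + 1)
    have hq1 : ρ ^ q ≤ 1 := pow_le_one₀ hρ.le hρ1
    rcases lt_or_ge m q with hmq | hmq
    · calc ρ ^ q * ((m + 1).factorial * #(indepSets G S (m + 1)))
          ≤ ρ ^ (m + 1) * (#S : ℝ) ^ (m + 1) := by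
            refine mul_le_mul (pow_le_pow_of_le_one hρ.le hρ1 hmq) htriv (by positivity)
              (by positivity)
        _ = (ρ * #S) ^ (m + 1) := (mul_pow _ _ _).symm
        _ ≤ (ρ * #S + s₀) ^ (m + 1) := by
            gcongr
            linarith
    rcases le_or_gt (#S : ℝ) s₀ with hs | hs
    · calc ρ ^ q * ((m + 1).factorial * #(indepSets G S (m + 1)))
          ≤ 1 * (#S : ℝ) ^ (m + 1) := mul_le_mul hq1 htriv (by positivity) (by positivity)
        _ ≤ (ρ * #S + s₀) ^ (m + 1) := by
            rw [one_mul]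
            gcongr
            have : 0 ≤ ρ * #S := by positivity
            linarith
    have hspos : (0 : ℝ) < #S := hs₀.trans_lt hs
    have hstep : ((m : ℝ) + 1) * #(indepSets G S (m + 1)) ≤
        ∑ x ∈ S, (#(indepSets G {y ∈ S | ¬ G.Adj x y} m) : ℝ) := by
      exact_mod_cast succ_mul_card_indepSets_le G S m
    have hterm : ∀ x ∈ S, ρ ^ q * (m.factorial * #(indepSets G {y ∈ S | ¬ G.Adj x y} m)) ≤
        (ρ * #S + s₀) ^ m * Real.exp (-(ρ * degIn G S x / (2 * #S)) * q) := by
      intro x _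
      refine (ih _ ((filter_subset _ _).trans hS)).trans ?_
      have hb := shrink_le_mul_exp hρ hρ1 hs₀ hs (Nat.cast_nonneg (degIn G S x))
      rw [← card_filter_not_adj] at hb
      refine (pow_le_pow_left₀ (by positivity) hb m).trans ?_
      rw [mul_pow, ← Real.exp_nat_mul]
      refine mul_le_mul_of_nonneg_left (Real.exp_le_exp.2 ?_) (by positivity)
      have h1 : (q : ℝ) ≤ m := by exact_mod_cast hmq
      have h2 : 0 ≤ ρ * degIn G S x / (2 * #S) := by positivity
      nlinarith
    calc ρ ^ q * ((m + 1).factorial * #(indepSets G S (m + 1)))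
        = ρ ^ q * m.factorial * ((m + 1) * #(indepSets G S (m + 1))) := by
          rw [Nat.factorial_succ]; push_cast; ring
      _ ≤ ρ ^ q * m.factorial *
          ∑ x ∈ S, (#(indepSets G {y ∈ S | ¬ G.Adj x y} m) : ℝ) := by gcongr
      _ = ∑ x ∈ S, ρ ^ q * (m.factorial * #(indepSets G {y ∈ S | ¬ G.Adj x y} m)) := by
          rw [mul_sum]; exact sum_congr rfl fun x _ => by ring
      _ ≤ ∑ x ∈ S, (ρ * #S + s₀) ^ m * Real.exp (-(ρ * degIn G S x / (2 * #S)) * q) :=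
          sum_le_sum hterm
      _ = (ρ * #S + s₀) ^ m * ∑ x ∈ S, Real.exp (-(ρ * degIn G S x / (2 * #S)) * q) := by
          rw [mul_sum]
      _ ≤ (ρ * #S + s₀) ^ m * (ρ * #S) := by
          gcongr
          exact hW S hS hs.le
      _ ≤ (ρ * #S + s₀) ^ (m + 1) := by
          rw [pow_succ]
          gcongr
          linarith

lemma card_indepSets_inter_le [DecidableEq α] [Fintype α] (G : SimpleGraph α) (W : Finset α) (k c : ℕ) :
    #{B ∈ indepSets G univ k | c ≤ #(B ∩ W)} ≤
      ∑ m ∈ range (k + 1) with c ≤ m,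
        #(indepSets G W m) * (Fintype.card α - #W).choose (k - m) := by
  have hmaps : Set.MapsTo (fun B : Finset α => #(B ∩ W))
      ({B ∈ indepSets G univ k | c ≤ #(B ∩ W)} : Finset (Finset α))
      ({m ∈ range (k + 1) | c ≤ m} : Finset ℕ) := by
    intro B hB
    simp only [indepSets, coe_filter, mem_filter, mem_powersetCard, Set.mem_ofPred_eq,
      mem_range] at hB ⊢
    exact ⟨Nat.lt_succ_of_le ((card_le_card inter_subset_left).trans hB.1.1.2.le), hB.2⟩
  rw [card_eq_sum_card_fiberwise hmaps]
  refine sum_le_sum fun m _ => ?_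
  rw [← card_compl, ← card_powersetCard, ← card_product]
  refine card_le_card_of_injOn (fun B => (B ∩ W, B \ W)) ?_ ?_
  · intro B hB
    simp only [indepSets, mem_coe, mem_filter, mem_powersetCard, mem_product] at hB ⊢
    obtain ⟨⟨⟨⟨-, hk⟩, hind⟩, -⟩, hm⟩ := hB
    refine ⟨⟨⟨inter_subset_right, hm⟩, hind.mono (by simp)⟩, fun x hx => ?_, ?_⟩
    · exact mem_compl.2 (mem_sdiff.1 hx).2
    · have := card_inter_add_card_sdiff B W
      omega
  · intro B _ C _ h
    simp only [Prod.mk.injEq] at h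
    rw [← sdiff_union_inter B W, ← sdiff_union_inter C W, h.1, h.2]

/-- Few `k`-sets are independent and meet `W` in at least `2q` points. -/
lemma factorial_mul_card_indepSets_inter_le [DecidableEq α] [Fintype α] (G : SimpleGraph α) (W : Finset α)
    {ρ s₀ : ℝ} (k q : ℕ) (hρ : 0 < ρ) (hρ1 : ρ ≤ 1) (hs₀ : 0 ≤ s₀)
    (hW : ∀ S ⊆ W, s₀ ≤ #S →
      ∑ x ∈ S, Real.exp (-(ρ * degIn G S x / (2 * #S)) * q) ≤ ρ * #S) :
    (k.factorial * #{B ∈ indepSets G univ k | 2 * q ≤ #(B ∩ W)} : ℝ) ≤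
      ρ ^ q * (Fintype.card α + s₀ / ρ) ^ k := by
  set n := Fintype.card α
  have hwn : #W ≤ n := card_le_univ W
  have hterm : ∀ m ∈ range (k + 1), 2 * q ≤ m →
      (k.factorial * (#(indepSets G W m) * (n - #W).choose (k - m) : ℕ) : ℝ) ≤
        ρ ^ q * ((#W + s₀ / ρ) ^ m * ((n : ℝ) - #W) ^ (k - m) * k.choose m) := by
    intro m hm hqm
    have hmk : m ≤ k := Nat.lt_succ_iff.1 (mem_range.1 hm)
    have h1 := factorial_mul_card_indepSets_le G W q hρ hρ1 hs₀ hW m W subset_rfl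
    have h2 : ((k - m).factorial * (n - #W).choose (k - m) : ℝ) ≤ ((n : ℝ) - #W) ^ (k - m) := by
      rw [← Nat.cast_sub hwn]
      exact_mod_cast (Nat.descFactorial_eq_factorial_mul_choose _ _).symm.le.trans
        (Nat.descFactorial_le_pow (n - #W) (k - m))
    have h3 : (k.factorial : ℝ) = k.choose m * m.factorial * (k - m).factorial := by
      exact_mod_cast (Nat.choose_mul_factorial_mul_factorial hmk).symm
    have h4 : (ρ * #W + s₀) ^ m ≤ ρ ^ q * (ρ ^ q * (#W + s₀ / ρ) ^ m) := by
      have : ρ * #W + s₀ = ρ * (#W + s₀ / ρ) := by field_simp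
      rw [this, mul_pow, ← mul_assoc, ← pow_add, ← two_mul]
      exact mul_le_mul_of_nonneg_right (pow_le_pow_of_le_one hρ.le hρ1 hqm) (by positivity)
    have h5 : (m.factorial * #(indepSets G W m) : ℝ) ≤ ρ ^ q * (#W + s₀ / ρ) ^ m :=
      le_of_mul_le_mul_left (h1.trans h4) (by positivity)
    calc (k.factorial * (#(indepSets G W m) * (n - #W).choose (k - m) : ℕ) : ℝ)
        = (m.factorial * #(indepSets G W m)) *
            ((k - m).factorial * (n - #W).choose (k - m)) * k.choose m := by
          rw [h3]; push_cast; ring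
      _ ≤ (ρ ^ q * (#W + s₀ / ρ) ^ m) * ((n : ℝ) - #W) ^ (k - m) * k.choose m := by
          gcongr
      _ = _ := by ring
  have hnw : (0 : ℝ) ≤ (n : ℝ) - #W := by
    rw [sub_nonneg]; exact_mod_cast hwn
  calc (k.factorial * #{B ∈ indepSets G univ k | 2 * q ≤ #(B ∩ W)} : ℝ)
      ≤ k.factorial * (∑ m ∈ range (k + 1) with 2 * q ≤ m,
          #(indepSets G W m) * (n - #W).choose (k - m) : ℕ) := by
        gcongr
        exact card_indepSets_inter_le G W k (2 * q)
    _ = ∑ m ∈ range (k + 1) with 2 * q ≤ m,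
          (k.factorial * (#(indepSets G W m) * (n - #W).choose (k - m) : ℕ) : ℝ) := by
        rw [Nat.cast_sum, mul_sum]
    _ ≤ ∑ m ∈ range (k + 1) with 2 * q ≤ m,
          ρ ^ q * ((#W + s₀ / ρ) ^ m * ((n : ℝ) - #W) ^ (k - m) * k.choose m) :=
        sum_le_sum fun m hm => hterm m (mem_filter.1 hm).1 (mem_filter.1 hm).2
    _ ≤ ∑ m ∈ range (k + 1),
          ρ ^ q * ((#W + s₀ / ρ) ^ m * ((n : ℝ) - #W) ^ (k - m) * k.choose m) :=
        sum_le_sum_of_subset_of_nonneg (filter_subset _ _) fun m _ _ => by positivity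
    _ = ρ ^ q * (n + s₀ / ρ) ^ k := by
        rw [← mul_sum, ← add_pow]
        congr 2
        ring

end IndependentSets

section Supersaturation

open scoped Classical
open Finset

variable {α : Type*}

lemma degIn_mono (G : SimpleGraph α) {S T : Finset α} (h : S ⊆ T) (x : α) :
    degIn G S x ≤ degIn G T x :=
  card_le_card (filter_subset_filter _ h)

/-- The graph whose edges are the pairs covered by a member of the family `A`. -/
def coverGraph {ι : Type*} (A : ι → Finset α) : SimpleGraph α where
  Adj x y := x ≠ y ∧ ∃ j, x ∈ A j ∧ y ∈ A j
  symm := ⟨fun _ _ h => ⟨h.1.symm, h.2.imp fun _ hj => ⟨hj.2, hj.1⟩⟩⟩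
  loopless := ⟨fun _ h => h.1 rfl⟩

lemma sum_card_offDiag_le_sum_degIn [DecidableEq α] {ι : Type*} [Fintype ι] (A : ι → Finset α)
    (hA : ∀ i j, i ≠ j → #(A i ∩ A j) ≤ 1) (S : Finset α) :
    ∑ j, #((A j ∩ S).offDiag) ≤ ∑ x ∈ S, degIn (coverGraph A) S x := by
  have hdisj : ((univ : Finset ι) : Set ι).PairwiseDisjoint fun j => (A j ∩ S).offDiag := by
    intro i _ j _ hij
    rw [Function.onFun, disjoint_left]
    rintro ⟨x, y⟩ hi hj
    simp only [mem_offDiag, mem_inter] at hi hj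
    exact hi.2.2 (card_le_one.1 (hA i j hij) x (mem_inter.2 ⟨hi.1.1, hj.1.1⟩) y
      (mem_inter.2 ⟨hi.2.1.1, hj.2.1.1⟩))
  rw [← card_biUnion hdisj]
  simp only [degIn]
  rw [← card_sigma]
  refine card_le_card_of_injOn (fun p => ⟨p.1, p.2⟩) ?_ ?_
  · rintro ⟨x, y⟩ h
    simp only [mem_coe, mem_biUnion, mem_univ, true_and, mem_offDiag, mem_inter] at h
    obtain ⟨j, ⟨hx, hxS⟩, ⟨hy, hyS⟩, hne⟩ := h
    simp only [mem_coe, mem_sigma, mem_filter]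
    exact ⟨hxS, hyS, hne, j, hx, hy⟩
  · rintro ⟨x, y⟩ _ ⟨x', y'⟩ _ h
    simpa using h

/-- The points lying in at least `H` members of the family `A`. -/
def highDeg [Fintype α] [DecidableEq α] {ι : Type*} [Fintype ι] (H : ℕ) (A : ι → Finset α) :
    Finset α :=
  {v | H ≤ #{j | v ∈ A j}}

/-- A packing in which every point of `S` has high degree covers many pairs inside `S`. -/
lemma sq_div_le_sum_degIn [Fintype α] [DecidableEq α] {i t : ℕ} (A : Fin i → Finset α)
    (hA : ∀ i j, i ≠ j → #(A i ∩ A j) ≤ 1) (hit : i ≤ t) (ht : 0 < t) {h : ℝ} {H : ℕ}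
    (hH : h ≤ H) (S : Finset α) (hS : S ⊆ highDeg H A) (hlarge : 2 * t ≤ h * #S) :
    (h * #S) ^ 2 / (2 * t) ≤ ∑ x ∈ S, (degIn (coverGraph A) S x : ℝ) := by
  have hcount : ∑ x ∈ S, #{j | x ∈ A j} = ∑ j, #(A j ∩ S) := by
    have h := sum_card_bipartiteAbove_eq_sum_card_bipartiteBelow
      (fun (x : α) (j : Fin i) => x ∈ A j) (s := S) (t := univ)
    simp only [bipartiteAbove, bipartiteBelow] at h
    rw [h]
    refine sum_congr rfl fun j _ => congrArg card ?_
    ext x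
    simp [and_comm]
  have hT : h * #S ≤ ∑ j, (#(A j ∩ S) : ℝ) := by
    have h1 : H * #S ≤ ∑ j, #(A j ∩ S) := by
      rw [← hcount, mul_comm, ← smul_eq_mul]
      exact card_nsmul_le_sum _ _ _ fun x hx => (mem_filter.1 (hS hx)).2
    calc h * #S ≤ H * #S := by gcongr
      _ ≤ _ := by exact_mod_cast h1
  have hoff : ∑ j, ((#(A j ∩ S) : ℝ) ^ 2 - #(A j ∩ S)) ≤
      ∑ x ∈ S, (degIn (coverGraph A) S x : ℝ) := by
    have h1 : (∑ j, (#((A j ∩ S).offDiag) : ℝ)) ≤ ∑ x ∈ S, (degIn (coverGraph A) S x : ℝ) := by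
      exact_mod_cast sum_card_offDiag_le_sum_degIn A hA S
    refine le_trans (le_of_eq (sum_congr rfl fun j _ => ?_)) h1
    rw [offDiag_card, Nat.cast_sub (Nat.le_mul_self _)]
    push_cast
    ring
  refine le_trans ?_ hoff
  rw [sum_sub_distrib]
  have hcs := sq_sum_le_card_mul_sum_sq (s := univ) (f := fun j => (#(A j ∩ S) : ℝ))
  simp only [card_univ, Fintype.card_fin] at hcs
  set T := ∑ j, (#(A j ∩ S) : ℝ)
  set Q := ∑ j, (#(A j ∩ S) : ℝ) ^ 2
  have hQ : 0 ≤ Q := sum_nonneg fun _ _ => by positivity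
  have htpos : (0 : ℝ) < t := by exact_mod_cast ht
  have hit' : (i : ℝ) ≤ t := by exact_mod_cast hit
  have hcs' : T ^ 2 ≤ t * Q := hcs.trans (by gcongr)
  rw [div_le_iff₀ (by positivity)]
  have h0 : 0 ≤ h * #S := le_trans (by positivity) hlarge
  nlinarith

lemma exp_neg_le_one_sub_min {v : ℝ} (hv : 0 ≤ v) : Real.exp (-v) ≤ 1 - min v 1 / 2 := by
  have h1 : Real.exp (-v) ≤ 1 / (1 + v) := by
    rw [Real.exp_neg, ← one_div]
    exact one_div_le_one_div_of_le (by linarith) (by linarith [Real.add_one_le_exp v])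
  refine h1.trans ?_
  rw [div_le_iff₀ (by linarith)]
  rcases le_total v 1 with h | h
  · rw [min_eq_left h]; nlinarith
  · rw [min_eq_right h]; nlinarith

/-- The degree condition for `ρ` close to one. -/
lemma sum_exp_degIn_le_of_le_one (G : SimpleGraph α) (W : Finset α) {σ D D' k : ℝ} {q : ℕ}
    (hk : 0 < k) (hq : k / 8 ≤ q) (hD' : 0 ≤ D') (hD'1 : D' ≤ 1) (hD : D' ≤ D)
    (hsat : ∀ S ⊆ W, σ ≤ #S → D / (128 * k) * #S ^ 2 ≤ ∑ x ∈ S, (degIn G S x : ℝ))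
    (S : Finset α) (hS : S ⊆ W) (hσS : 2 * σ ≤ #S) :
    ∑ x ∈ S, Real.exp (-(Real.exp (-(D' / 32768)) * degIn G S x / (2 * #S)) * q) ≤
      Real.exp (-(D' / 32768)) * #S := by
  have hρ : 1 - D' / 32768 ≤ Real.exp (-(D' / 32768)) := by
    linarith [Real.add_one_le_exp (-(D' / 32768))]
  set ρ := Real.exp (-(D' / 32768))
  rcases S.eq_empty_or_nonempty with rfl | hne
  · simp
  have hs : (0 : ℝ) < #S := by exact_mod_cast hne.card_pos
  have hD0 : 0 ≤ D := hD'.trans hD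
  set s : ℝ := (#S : ℝ) with hs_def
  set v : α → ℝ := fun x => k * degIn G S x / (32 * s) with hv_def
  have hv0 : ∀ x, 0 ≤ v x := fun x => by positivity
  have hterm : ∀ x ∈ S, Real.exp (-(ρ * degIn G S x / (2 * s)) * q) ≤ 1 - min (v x) 1 / 2 := by
    intro x _
    refine le_trans (Real.exp_le_exp.2 ?_) (exp_neg_le_one_sub_min (hv0 x))
    rw [neg_mul, neg_le_neg_iff]
    calc v x = (1 / 2) * degIn G S x / (2 * s) * (k / 8) := by
          simp only [hv_def]; field_simp; ring
      _ ≤ ρ * degIn G S x / (2 * s) * q := by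
          gcongr
          linarith
  have hsum : ∑ x ∈ S, Real.exp (-(ρ * degIn G S x / (2 * s)) * q) ≤
      s - (∑ x ∈ S, min (v x) 1) / 2 := by
    refine (sum_le_sum hterm).trans (le_of_eq ?_)
    rw [sum_sub_distrib, sum_div]
    simp [hs_def]
  refine hsum.trans ?_
  suffices hmin : D' / 16384 * s ≤ ∑ x ∈ S, min (v x) 1 by nlinarith
  set S' : Finset α := {x ∈ S | v x < 1} with hS'
  have hsplit := card_filter_add_card_filter_not (s := S) (fun x => v x < 1)
  rcases le_or_gt (s / 2) #S' with hcase | hcase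
  · have h1 := hsat S' ((filter_subset _ _).trans hS) (by linarith)
    have h2 : ∑ x ∈ S', (degIn G S' x : ℝ) ≤ ∑ x ∈ S', (degIn G S x : ℝ) :=
      sum_le_sum fun x _ => by exact_mod_cast degIn_mono G (filter_subset _ _) x
    have h3 : ∑ x ∈ S', v x ≤ ∑ x ∈ S, min (v x) 1 := by
      calc ∑ x ∈ S', v x = ∑ x ∈ S', min (v x) 1 :=
            sum_congr rfl fun x hx => (min_eq_left (mem_filter.1 hx).2.le).symm
        _ ≤ _ := sum_le_sum_of_subset_of_nonneg (filter_subset _ _) fun x _ _ =>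
            le_min (hv0 x) zero_le_one
    have h4 : ∑ x ∈ S', v x = k / (32 * s) * ∑ x ∈ S', (degIn G S x : ℝ) := by
      rw [mul_sum]
      exact sum_congr rfl fun x _ => by simp only [hv_def]; ring
    calc D' / 16384 * s = k / (32 * s) * (D' / (128 * k) * (s / 2) ^ 2) := by
          field_simp; ring
      _ ≤ k / (32 * s) * (D / (128 * k) * (#S' : ℝ) ^ 2) := by gcongr
      _ ≤ k / (32 * s) * ∑ x ∈ S', (degIn G S x : ℝ) := by
          gcongr
          exact h1.trans h2
      _ ≤ _ := h4.symm.le.trans h3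
  · have h1 : ∑ x ∈ S with ¬ v x < 1, (1 : ℝ) ≤ ∑ x ∈ S, min (v x) 1 := by
      calc ∑ x ∈ S with ¬ v x < 1, (1 : ℝ) = ∑ x ∈ S with ¬ v x < 1, min (v x) 1 :=
            sum_congr rfl fun x hx =>
              (min_eq_right (not_lt.1 (mem_filter.1 hx).2)).symm
        _ ≤ _ := sum_le_sum_of_subset_of_nonneg (filter_subset _ _) fun x _ _ =>
            le_min (hv0 x) zero_le_one
    have h2 : (#S' : ℝ) + #{x ∈ S | ¬ v x < 1} = s := by
      rw [hs_def]; exact_mod_cast hsplit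
    rw [sum_const, nsmul_eq_mul, mul_one] at h1
    nlinarith

/-- The degree condition for small `ρ`. -/
lemma sum_exp_degIn_le_of_small (G : SimpleGraph α) (W : Finset α) {σ D ρ k : ℝ} {q : ℕ}
    (hk : 0 < k) (hq : k / 8 ≤ q) (hρ : 0 < ρ) (hρ1 : ρ ≤ 1 / 100) (hD : ρ ^ 8 * D = 1)
    (hsat : ∀ S ⊆ W, σ ≤ #S → D / (128 * k) * #S ^ 2 ≤ ∑ x ∈ S, (degIn G S x : ℝ))
    (S : Finset α) (hS : S ⊆ W) (hσS : σ / ρ ^ 4 ≤ #S) :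
    ∑ x ∈ S, Real.exp (-(ρ * degIn G S x / (2 * #S)) * q) ≤ ρ * #S := by
  rcases S.eq_empty_or_nonempty with rfl | hne
  · simp
  have hs : (0 : ℝ) < #S := by exact_mod_cast hne.card_pos
  set s : ℝ := (#S : ℝ) with hs_def
  set S' : Finset α := {x ∈ S | 128 * ρ ^ 4 * k * degIn G S x < s} with hS'
  have hS'card : (#S' : ℝ) ≤ ρ ^ 4 * s := by
    by_contra! hlt
    rw [div_le_iff₀ (by positivity)] at hσS
    have h1 := hsat S' ((filter_subset _ _).trans hS) (by linarith)
    have h2 : ∑ x ∈ S', (degIn G S' x : ℝ) ≤ ∑ x ∈ S', s / (128 * ρ ^ 4 * k) := by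
      refine sum_le_sum fun x hx => ?_
      have h3 : (degIn G S' x : ℝ) ≤ degIn G S x := by
        exact_mod_cast degIn_mono G (filter_subset _ _) x
      refine h3.trans ?_
      rw [le_div_iff₀ (by positivity)]
      linarith [(mem_filter.1 hx).2]
    rw [sum_const, nsmul_eq_mul] at h2
    have h4 := h1.trans h2
    have hS'pos : (0 : ℝ) < #S' := lt_trans (by positivity) hlt
    have h5 : D * #S' ≤ s / ρ ^ 4 := by
      have e1 : D / (128 * k) * (#S' : ℝ) ^ 2 = (#S' / (128 * k)) * (D * #S') := by ring
      have e2 : (#S' : ℝ) * (s / (128 * ρ ^ 4 * k)) = (#S' / (128 * k)) * (s / ρ ^ 4) := by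
        field_simp
      rw [e1, e2] at h4
      exact le_of_mul_le_mul_left h4 (by positivity)
    have h6 : ρ ^ 8 * (D * #S') ≤ ρ ^ 8 * (s / ρ ^ 4) := by gcongr
    have e3 : ρ ^ 8 * (s / ρ ^ 4) = ρ ^ 4 * s := by field_simp
    rw [← mul_assoc, hD, e3] at h6
    linarith
  have hterm : ∀ x ∈ S, Real.exp (-(ρ * degIn G S x / (2 * s)) * q) ≤
      (if 128 * ρ ^ 4 * k * degIn G S x < s then 1 else 0) + 2048 * ρ ^ 3 := by
    intro x _
    split_ifs with hx
    · have h1 : Real.exp (-(ρ * degIn G S x / (2 * s)) * q) ≤ 1 := by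
        rw [Real.exp_le_one_iff, neg_mul, neg_nonpos]
        positivity
      have : 0 ≤ 2048 * ρ ^ 3 := by positivity
      linarith
    · rw [not_lt] at hx
      have h1 : 1 / (2048 * ρ ^ 3) ≤ ρ * degIn G S x / (2 * s) * q := by
        calc 1 / (2048 * ρ ^ 3) = ρ / (16 * s) * (s / (128 * ρ ^ 4)) := by
              field_simp; norm_num
          _ ≤ ρ / (16 * s) * (k * degIn G S x) := by
              gcongr
              rw [div_le_iff₀ (by positivity)]
              linarith
          _ = ρ * degIn G S x / (2 * s) * (k / 8) := by field_simp; ring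
          _ ≤ _ := by gcongr
      have h2 : 0 < 1 / (2048 * ρ ^ 3) := by positivity
      rw [neg_mul, Real.exp_neg, zero_add]
      refine inv_le_of_inv_le₀ (by positivity) ?_
      rw [← one_div]
      linarith [Real.add_one_le_exp (ρ * degIn G S x / (2 * s) * q)]
  refine (sum_le_sum hterm).trans ?_
  rw [sum_add_distrib, sum_const, nsmul_eq_mul, ← sum_filter, sum_const, nsmul_eq_mul, mul_one]
  calc (#S' : ℝ) + s * (2048 * ρ ^ 3) ≤ ρ ^ 4 * s + s * (2048 * ρ ^ 3) := by gcongr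
    _ = ρ * s * (ρ ^ 3 + 2048 * ρ ^ 2) := by ring
    _ ≤ ρ * s * 1 := by
        have h2 : ρ ^ 2 ≤ (1 / 100) ^ 2 := by gcongr
        have h3 : ρ ^ 3 ≤ (1 / 100) ^ 3 := by gcongr
        have : ρ ^ 3 + 2048 * ρ ^ 2 ≤ 1 := by linarith
        gcongr
    _ = ρ * s := mul_one _

end Supersaturation

section Packings

open scoped Classical
open Finset

variable {α : Type*} [DecidableEq α]

lemma card_filter_mem_succ {t : ℕ} (A : Fin (t + 1) → Finset α) (v : α) :
    #{j | v ∈ A j} = (if v ∈ A 0 then 1 else 0) + #{j | v ∈ Fin.tail A j} := by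
  simp only [card_filter, Fin.sum_univ_succ]
  rfl

variable [Fintype α]

/-- The sequences of `t` sets of size `k` that form a packing. -/
noncomputable def packings (α : Type*) [Fintype α] [DecidableEq α] (k t : ℕ) :
    Finset (Fin t → Finset α) :=
  {A | (∀ i, #(A i) = k) ∧ ∀ i j, i ≠ j → #(A i ∩ A j) ≤ 1}

/-- The number of indices `i` such that `A i` meets the set of points of degree at least `H` in
the later part of the sequence in at least `c` points. -/
noncomputable def heavySteps (H c : ℕ) : (t : ℕ) → (Fin t → Finset α) → ℕ
  | 0, _ => 0
  | t + 1, A => heavySteps H c t (Fin.tail A) +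
      if c ≤ #(A 0 ∩ highDeg H (Fin.tail A)) then 1 else 0

/-- Each point is covered at most `H` times before its degree reaches `H`. -/
lemma mul_sub_le_heavySteps {k H c : ℕ} :
    ∀ (t : ℕ) (A : Fin t → Finset α), (∀ i, #(A i) = k) →
      t * (k - c) ≤ heavySteps H c t A * (k - c) + ∑ v, min (#{j | v ∈ A j}) H
  | 0, _, _ => by simp
  | t + 1, A, hA => by
    have ih := mul_sub_le_heavySteps (H := H) (c := c) t (Fin.tail A) fun i => hA i.succ
    have hmono : ∀ v, min (#{j | v ∈ Fin.tail A j}) H +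
        (if v ∈ A 0 \ highDeg H (Fin.tail A) then 1 else 0) ≤ min (#{j | v ∈ A j}) H := by
      intro v
      rw [card_filter_mem_succ A v]
      simp only [mem_sdiff, highDeg, mem_filter, mem_univ, true_and]
      split_ifs <;> first | omega | tauto
    have hsum := sum_le_sum (s := univ) fun v _ => hmono v
    rw [sum_add_distrib, ← card_filter, filter_mem_eq_inter, univ_inter] at hsum
    have hsplit := card_inter_add_card_sdiff (A 0) (highDeg H (Fin.tail A))
    rw [hA 0] at hsplit
    simp only [heavySteps]
    split_ifs with hc
    · nlinarith
    · have : k - c ≤ #(A 0 \ highDeg H (Fin.tail A)) := by omega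
      nlinarith

/-- If every packing has few heavy extensions, then heavy steps are rare. -/
lemma sum_pow_heavySteps_le {k H c T : ℕ} {y : ℝ} (hy : 0 ≤ y)
    (hext : ∀ t < T, ∀ A ∈ packings α k t,
      y * #{B ∈ powersetCard k univ | (∀ j, #(B ∩ A j) ≤ 1) ∧ c ≤ #(B ∩ highDeg H A)} ≤
        (Fintype.card α).choose k) :
    ∀ t ≤ T, ∑ A ∈ packings α k t, y ^ heavySteps H c t A ≤
      (2 * ((Fintype.card α).choose k : ℝ)) ^ t
  | 0, _ => by
    simp only [heavySteps, pow_zero, sum_const, nsmul_eq_mul, mul_one]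
    have : #(packings α k 0) ≤ 1 := (card_le_univ _).trans (by simp)
    exact_mod_cast this
  | t + 1, ht => by
    have ih := sum_pow_heavySteps_le hy hext t (by omega)
    set E : (Fin t → Finset α) → Finset (Finset α) := fun A =>
      {B ∈ powersetCard k univ | ∀ j, #(B ∩ A j) ≤ 1}
    set w : (Fin t → Finset α) → Finset α → ℝ := fun A B =>
      y ^ (if c ≤ #(B ∩ highDeg H A) then 1 else 0)
    have hw : ∀ A B, 0 ≤ w A B := fun A B => by positivity
    have hstep : ∀ A ∈ packings α k t,
        ∑ B ∈ E A, w A B ≤ 2 * ((Fintype.card α).choose k : ℝ) := by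
      intro A hA
      have h1 : ∑ B ∈ E A with c ≤ #(B ∩ highDeg H A), w A B ≤ (Fintype.card α).choose k := by
        refine le_trans (le_of_eq ?_) (hext t (by omega) A hA)
        rw [sum_congr rfl (g := fun _ => y), sum_const, nsmul_eq_mul, mul_comm, filter_filter]
        intro B hB
        simp only [w, if_pos (mem_filter.1 hB).2, pow_one]
      have h2 : ∑ B ∈ E A with ¬ c ≤ #(B ∩ highDeg H A), w A B ≤
          (Fintype.card α).choose k := by
        rw [sum_congr rfl (g := fun _ => (1 : ℝ)), sum_const, nsmul_eq_mul, mul_one]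
        · have : #{B ∈ E A | ¬ c ≤ #(B ∩ highDeg H A)} ≤ (Fintype.card α).choose k := by
            rw [← card_univ, ← card_powersetCard]
            exact card_le_card ((filter_subset _ _).trans (filter_subset _ _))
          exact_mod_cast this
        · intro B hB
          simp only [w, if_neg (mem_filter.1 hB).2, pow_zero]
      rw [← sum_filter_add_sum_filter_not (E A) (fun B => c ≤ #(B ∩ highDeg H A))]
      linarith
    calc ∑ A ∈ packings α k (t + 1), y ^ heavySteps H c (t + 1) A
        ≤ ∑ p ∈ (packings α k t).sigma E, y ^ heavySteps H c t p.1 * w p.1 p.2 := by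
          rw [← sum_image (f := fun p : (_ : Fin t → Finset α) × Finset α =>
            y ^ heavySteps H c t p.1 * w p.1 p.2) (s := packings α k (t + 1))
            (g := fun A => ⟨Fin.tail A, A 0⟩) ?_ |>.trans
            (sum_congr rfl fun A _ => by simp only [w, heavySteps, pow_add])]
          · refine sum_le_sum_of_subset_of_nonneg ?_ fun p _ _ =>
              mul_nonneg (by positivity) (hw _ _)
            intro p hp
            obtain ⟨A, hA, rfl⟩ := mem_image.1 hp
            simp only [packings, mem_filter, mem_univ, true_and] at hA
            simp only [mem_sigma, packings, mem_filter, mem_univ, true_and, E,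
              mem_powersetCard, subset_univ]
            exact ⟨⟨fun i => hA.1 _, fun i j hij => hA.2 _ _ fun h => hij (Fin.succ_injective _ h)⟩,
              hA.1 0, fun j => hA.2 _ _ (Fin.succ_ne_zero j).symm⟩
          · intro A _ B _ h
            simp only [Sigma.mk.injEq, heq_eq_eq] at h
            rw [← Fin.cons_self_tail A, ← Fin.cons_self_tail B, h.1, h.2]
      _ = ∑ A ∈ packings α k t, y ^ heavySteps H c t A * ∑ B ∈ E A, w A B := by
          rw [sum_sigma]
          exact sum_congr rfl fun A _ => by rw [mul_sum]
      _ ≤ ∑ A ∈ packings α k t,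
            y ^ heavySteps H c t A * (2 * ((Fintype.card α).choose k : ℝ)) :=
          sum_le_sum fun A hA => mul_le_mul_of_nonneg_left (hstep A hA) (by positivity)
      _ = (∑ A ∈ packings α k t, y ^ heavySteps H c t A) *
            (2 * ((Fintype.card α).choose k : ℝ)) := (sum_mul _ _ _).symm
      _ ≤ (2 * ((Fintype.card α).choose k : ℝ)) ^ (t + 1) := by
          rw [pow_succ]
          gcongr

/-- A packing covers every pair at most once. -/
lemma mul_le_of_packing_nonempty {k t : ℕ} (h : (packings α k t).Nonempty) :
    t * (k * k - k) ≤ Fintype.card α * Fintype.card α := by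
  obtain ⟨A, hA⟩ := h
  simp only [packings, mem_filter, mem_univ, true_and] at hA
  have h1 := sum_card_offDiag_le_sum_degIn A hA.2 univ
  simp only [inter_univ, offDiag_card, hA.1, sum_const, card_univ, Fintype.card_fin,
    smul_eq_mul] at h1
  refine h1.trans ((sum_le_card_nsmul _ _ (Fintype.card α) fun x _ => ?_).trans ?_)
  · exact (card_filter_le _ _)
  · simp

end Packings

section Assembly

open scoped Classical
open Finset

lemma zeta_eq (n k t : ℕ) :
    zeta n k t = #(packings (Fin n) k t) / (n.choose k : ℝ) ^ t := by
  rw [zeta, Nat.card_eq_fintype_card, Fintype.card_subtype, packings]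

/-- If `k` is small compared with `√n`, then `choose n k` is almost `n ^ k / k!`. -/
lemma pow_le_factorial_mul_choose {n k : ℕ} (hk : 0 < k) (hkn : 2 * (k : ℝ) ^ 2 ≤ n) :
    (n : ℝ) ^ k ≤ 2 * (k.factorial * n.choose k) := by
  have hk1 : (1 : ℝ) ≤ k := by exact_mod_cast hk
  have hn : (0 : ℝ) < n := lt_of_lt_of_le (by positivity) hkn
  have hkn' : (k : ℝ) ≤ n := by nlinarith
  have hkn'' : k ≤ n := by exact_mod_cast hkn'
  have h1 : ((n : ℝ) - k) ^ k ≤ k.factorial * n.choose k := by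
    have h2 : (n - k) ^ k ≤ k.factorial * n.choose k := by
      rw [← Nat.descFactorial_eq_factorial_mul_choose]
      exact (Nat.pow_le_pow_left (by omega) k).trans (Nat.pow_sub_le_descFactorial n k)
    rw [← Nat.cast_sub hkn'']
    exact_mod_cast h2
  have h3 : (k : ℝ) * k / n ≤ 1 / 2 := by
    rw [div_le_iff₀ hn]; nlinarith
  have h4 : 1 / 2 ≤ (1 + -((k : ℝ) / n)) ^ k := by
    refine le_trans ?_ (one_add_mul_le_pow ?_ k)
    · have : (k : ℝ) * -((k : ℝ) / n) = -((k : ℝ) * k / n) := by ring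
      rw [this]; linarith
    · have : (k : ℝ) / n ≤ 1 := by rw [div_le_one hn]; exact hkn'
      linarith
  have h5 : ((n : ℝ) - k) ^ k = (n : ℝ) ^ k * (1 + -((k : ℝ) / n)) ^ k := by
    rw [← mul_pow]; congr 1; field_simp; ring
  have h6 : 0 ≤ (n : ℝ) ^ k := by positivity
  nlinarith

/-- Few `k`-sets extend a given packing while meeting its high-degree points often. -/
lemma card_heavy_extensions_le {n k t i H q : ℕ} {ρ s₀ h : ℝ} (hk : 0 < k)
    (hkn : 2 * (k : ℝ) ^ 2 ≤ n) (ht : 0 < t) (hit : i ≤ t) (hH : h ≤ H)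
    (hh : h = t * k / (8 * n)) (hρ : 0 < ρ) (hρ1 : ρ ≤ 1) (hs₀ : 0 ≤ s₀)
    (hdeg : ∀ (G : SimpleGraph (Fin n)) (W : Finset (Fin n)),
      (∀ S ⊆ W, 16 * (n : ℝ) / k ≤ #S →
        (t * k ^ 3 / n ^ 2) / (128 * k) * (#S : ℝ) ^ 2 ≤ ∑ x ∈ S, (degIn G S x : ℝ)) →
      ∀ S ⊆ W, s₀ ≤ #S →
        ∑ x ∈ S, Real.exp (-(ρ * degIn G S x / (2 * #S)) * q) ≤ ρ * #S)
    (A : Fin i → Finset (Fin n)) (hA : A ∈ packings (Fin n) k i) :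
    (#{B ∈ powersetCard k univ | (∀ j, #(B ∩ A j) ≤ 1) ∧ 2 * q ≤ #(B ∩ highDeg H A)} : ℝ) ≤
      2 * (ρ ^ q * Real.exp (k * (s₀ / (ρ * n)))) * n.choose k := by
  have hk0 : (0 : ℝ) < k := by exact_mod_cast hk
  have ht0 : (0 : ℝ) < t := by exact_mod_cast ht
  have hn : (0 : ℝ) < n := lt_of_lt_of_le (by positivity) hkn
  simp only [packings, mem_filter, mem_univ, true_and] at hA
  have hsat : ∀ S ⊆ highDeg H A, 16 * (n : ℝ) / k ≤ #S →
      (t * k ^ 3 / n ^ 2) / (128 * k) * (#S : ℝ) ^ 2 ≤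
        ∑ x ∈ S, (degIn (coverGraph A) S x : ℝ) := by
    intro S hS hlarge
    have h1 : 2 * (t : ℝ) ≤ h * #S := by
      calc 2 * (t : ℝ) = h * (16 * n / k) := by rw [hh]; field_simp; norm_num
        _ ≤ h * #S := by
          rw [hh]
          gcongr
    refine le_trans (le_of_eq ?_) (sq_div_le_sum_degIn A hA.2 hit ht hH S hS h1)
    rw [hh]; field_simp; ring
  have hmain := factorial_mul_card_indepSets_inter_le (coverGraph A) (highDeg H A) k q hρ hρ1 hs₀
    (hdeg _ _ hsat)
  rw [Fintype.card_fin] at hmain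
  have hsub : #{B ∈ powersetCard k univ | (∀ j, #(B ∩ A j) ≤ 1) ∧ 2 * q ≤ #(B ∩ highDeg H A)} ≤
      #{B ∈ indepSets (coverGraph A) univ k | 2 * q ≤ #(B ∩ highDeg H A)} := by
    refine card_le_card fun B hB => ?_
    simp only [indepSets, mem_filter] at hB ⊢
    refine ⟨⟨hB.1, fun x hx y hy hne hadj => ?_⟩, hB.2.2⟩
    obtain ⟨-, j, hxj, hyj⟩ := hadj
    exact hne (card_le_one.1 (hB.2.1 j) x (mem_inter.2 ⟨hx, hxj⟩) y (mem_inter.2 ⟨hy, hyj⟩))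
  have hpow : ((n : ℝ) + s₀ / ρ) ^ k ≤ (n : ℝ) ^ k * Real.exp (k * (s₀ / (ρ * n))) := by
    rw [Real.exp_nat_mul, ← mul_pow]
    refine pow_le_pow_left₀ (by positivity) ?_ k
    calc (n : ℝ) + s₀ / ρ = n * (s₀ / (ρ * n) + 1) := by field_simp; ring
      _ ≤ _ := by gcongr; exact Real.add_one_le_exp _
  have hchoose := pow_le_factorial_mul_choose hk hkn
  have hfac : (0 : ℝ) < k.factorial := by exact_mod_cast k.factorial_pos
  refine le_of_mul_le_mul_left ?_ hfac
  calc (k.factorial : ℝ) *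
        #{B ∈ powersetCard k univ | (∀ j, #(B ∩ A j) ≤ 1) ∧ 2 * q ≤ #(B ∩ highDeg H A)}
      ≤ k.factorial * #{B ∈ indepSets (coverGraph A) univ k | 2 * q ≤ #(B ∩ highDeg H A)} := by
        gcongr
    _ ≤ ρ ^ q * (n + s₀ / ρ) ^ k := hmain
    _ ≤ ρ ^ q * (2 * (k.factorial * n.choose k) * Real.exp (k * (s₀ / (ρ * n)))) := by
        gcongr
        exact hpow.trans (by gcongr)
    _ = _ := by ring

/-- The packing probability is small as soon as heavy extensions are rare. -/
lemma zeta_le_pow {n k t H q : ℕ} {p : ℝ} (hkn : k ≤ n) (hp : 0 < p) (hp1 : p ≤ 1)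
    (hq : 4 * q ≤ k) (hk : 0 < k) (hH : 4 * n * H ≤ t * k)
    (hext : ∀ i < t, ∀ A ∈ packings (Fin n) k i,
      (#{B ∈ powersetCard k univ | (∀ j, #(B ∩ A j) ≤ 1) ∧ 2 * q ≤ #(B ∩ highDeg H A)} : ℝ) ≤
        p * n.choose k) :
    zeta n k t ^ 2 ≤ (4 * p) ^ t := by
  have hC : (0 : ℝ) < n.choose k := by exact_mod_cast Nat.choose_pos hkn
  have hsum := sum_pow_heavySteps_le (α := Fin n) (k := k) (H := H) (c := 2 * q) (T := t)
    (y := p⁻¹) (by positivity) (fun i hi A hA => by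
      rw [Fintype.card_fin, inv_mul_le_iff₀ hp]; exact hext i hi A hA) t le_rfl
  rw [Fintype.card_fin] at hsum
  have hheavy : ∀ A ∈ packings (Fin n) k t, t ≤ 2 * heavySteps H (2 * q) t A := by
    intro A hA
    simp only [packings, mem_filter, mem_univ, true_and] at hA
    have h1 := mul_sub_le_heavySteps (H := H) (c := 2 * q) t A hA.1
    have h2 : ∑ v, min (#{j | v ∈ A j}) H ≤ n * H := by
      refine (sum_le_card_nsmul _ _ H fun v _ => min_le_right _ _).trans ?_
      simp
    have h3 : k ≤ 2 * (k - 2 * q) := by omega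
    set g := heavySteps H (2 * q) t A
    set r := k - 2 * q
    by_contra! hlt
    have h4 : (2 * g + 1) * r ≤ t * r := Nat.mul_le_mul_right _ hlt
    have h5 : t * k ≤ t * (2 * r) := Nat.mul_le_mul_left _ h3
    have h6 : 0 < r := by omega
    nlinarith
  have hlow : (#(packings (Fin n) k t) : ℝ) ^ 2 * (p⁻¹) ^ t ≤
      (2 * (n.choose k : ℝ)) ^ (2 * t) := by
    obtain ⟨r, hr1, hr2⟩ : ∃ r : ℝ, 1 ≤ r ∧ p⁻¹ = r ^ 2 :=
      ⟨√(p⁻¹), Real.one_le_sqrt.2 ((one_le_inv₀ hp).2 hp1), (Real.sq_sqrt (by positivity)).symm⟩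
    rw [hr2] at hsum ⊢
    have h1 : (#(packings (Fin n) k t) : ℝ) * r ^ t ≤ (2 * (n.choose k : ℝ)) ^ t := by
      refine le_trans ?_ hsum
      rw [← nsmul_eq_mul]
      refine card_nsmul_le_sum _ _ _ fun A hA => ?_
      rw [← pow_mul]
      exact pow_le_pow_right₀ hr1 (hheavy A hA)
    calc (#(packings (Fin n) k t) : ℝ) ^ 2 * (r ^ 2) ^ t
        = (#(packings (Fin n) k t) * r ^ t) ^ 2 := by ring
      _ ≤ ((2 * (n.choose k : ℝ)) ^ t) ^ 2 := by gcongr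
      _ = (2 * (n.choose k : ℝ)) ^ (2 * t) := by rw [← pow_mul, mul_comm t 2]
  rw [zeta_eq, div_pow, div_le_iff₀ (by positivity)]
  have e : (4 * p) ^ t * ((n.choose k : ℝ) ^ t) ^ 2 = p ^ t * (2 * (n.choose k : ℝ)) ^ (2 * t) := by
    rw [mul_pow, mul_pow, ← pow_mul, pow_mul 2 2 t]; norm_num; ring
  rw [e]
  calc (#(packings (Fin n) k t) : ℝ) ^ 2
      = p ^ t * ((#(packings (Fin n) k t) : ℝ) ^ 2 * (p⁻¹) ^ t) := by
        rw [inv_pow]; field_simp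
    _ ≤ _ := by gcongr

lemma zeta_lt_exp {n k t : ℕ} {ρ s₀ y : ℝ} (hk : 8 ≤ k) (hkn : 2 * (k : ℝ) ^ 2 ≤ n) (ht : 0 < t)
    (htk : 8 * (n : ℝ) ≤ t * k) (hρ : 0 < ρ) (hρ1 : ρ ≤ 1) (hs₀ : 0 ≤ s₀) (hy : 0 ≤ y)
    (hdeg : ∀ (G : SimpleGraph (Fin n)) (W : Finset (Fin n)),
      (∀ S ⊆ W, 16 * (n : ℝ) / k ≤ #S →
        (t * k ^ 3 / n ^ 2) / (128 * k) * (#S : ℝ) ^ 2 ≤ ∑ x ∈ S, (degIn G S x : ℝ)) →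
      ∀ S ⊆ W, s₀ ≤ #S →
        ∑ x ∈ S, Real.exp (-(ρ * degIn G S x / (2 * #S)) * (k / 4 : ℕ)) ≤ ρ * #S)
    (hnum : 8 * (ρ ^ (k / 4) * Real.exp (k * (s₀ / (ρ * n)))) < Real.exp (-(2 * y * k))) :
    zeta n k t < Real.exp (-(y * t * k)) := by
  have hk0 : (0 : ℝ) < k := by exact_mod_cast (by omega : 0 < k)
  have hk1 : (1 : ℝ) ≤ k := by exact_mod_cast (by omega : 1 ≤ k)
  have hn : (0 : ℝ) < n := lt_of_lt_of_le (by positivity) hkn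
  have hkn' : k ≤ n := by
    have : (k : ℝ) ≤ n := by nlinarith
    exact_mod_cast this
  set p : ℝ := 2 * (ρ ^ (k / 4) * Real.exp (k * (s₀ / (ρ * n))))
  have hp : 0 < p := by positivity
  have hp4 : 4 * p < Real.exp (-(2 * y * k)) := by
    refine lt_of_eq_of_lt ?_ hnum
    simp only [p]; ring
  have hp1 : p ≤ 1 := by
    have : Real.exp (-(2 * y * k)) ≤ 1 := by
      rw [Real.exp_le_one_iff, neg_nonpos]; positivity
    linarith
  have hH : 4 * n * ⌈(t * k / (8 * n) : ℝ)⌉₊ ≤ t * k := by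
    have h1 := (Nat.ceil_lt_add_one (a := (t * k / (8 * n) : ℝ)) (by positivity)).le
    have h2 : 4 * (n : ℝ) * ⌈(t * k / (8 * n) : ℝ)⌉₊ ≤ t * k := by
      calc 4 * (n : ℝ) * ⌈(t * k / (8 * n) : ℝ)⌉₊ ≤ 4 * n * (t * k / (8 * n) + 1) := by gcongr
        _ = t * k / 2 + 4 * n := by field_simp; ring
        _ ≤ t * k := by linarith
    exact_mod_cast h2
  have hzeta := zeta_le_pow (H := ⌈(t * k / (8 * n) : ℝ)⌉₊) (q := k / 4) hkn' hp hp1 (by omega)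
    (by omega) hH fun i hi A hA =>
      card_heavy_extensions_le (by omega) hkn ht hi.le (Nat.le_ceil _) rfl hρ hρ1 hs₀ hdeg A hA
  refine lt_of_pow_lt_pow_left₀ 2 (Real.exp_pos _).le (hzeta.trans_lt ?_)
  calc (4 * p) ^ t < Real.exp (-(2 * y * k)) ^ t :=
        pow_lt_pow_left₀ hp4 (by positivity) ht.ne'
    _ = Real.exp (-(y * t * k)) ^ 2 := by
        rw [← Real.exp_nat_mul, ← Real.exp_nat_mul]
        congr 1
        push_cast
        ring

lemma eight_le_exp_three : (8 : ℝ) ≤ Real.exp 3 := by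
  have h := Real.add_one_le_exp (1 : ℝ)
  have h2 : Real.exp 3 = Real.exp 1 ^ 3 := by rw [← Real.exp_nat_mul]; norm_num
  rw [h2]
  calc (8 : ℝ) = (1 + 1) ^ 3 := by norm_num
    _ ≤ _ := by gcongr

lemma div_eight_le_div_four {k : ℕ} (hk : 8 ≤ k) : (k : ℝ) / 8 ≤ (k / 4 : ℕ) := by
  have h : k ≤ 8 * (k / 4) := by omega
  have h' : (k : ℝ) ≤ 8 * (k / 4 : ℕ) := by exact_mod_cast h
  linarith

lemma zeta_lt_exp_of_bounded {n k t : ℕ} {D D' y : ℝ} (hk : 8 ≤ k) (hkn : 2 * (k : ℝ) ^ 2 ≤ n)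
    (ht : 0 < t) (htk : 8 * (n : ℝ) ≤ t * k) (hD : t * k ^ 3 / n ^ 2 = D) (hD' : 0 ≤ D')
    (hD'1 : D' ≤ 1) (hDD : D' ≤ D) (hy : 0 ≤ y) (hyD : 2 * y ≤ D' / 32768 / 16)
    (hlarge : 67 < D' / 32768 / 16 * k) :
    zeta n k t < Real.exp (-(y * t * k)) := by
  have hk0 : (0 : ℝ) < k := by exact_mod_cast (by omega : 0 < k)
  have hn : (0 : ℝ) < n := lt_of_lt_of_le (by positivity) hkn
  have hq := div_eight_le_div_four hk
  have hρ : 1 / 2 ≤ Real.exp (-(D' / 32768)) := by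
    linarith [Real.add_one_le_exp (-(D' / 32768))]
  refine zeta_lt_exp (ρ := Real.exp (-(D' / 32768))) (s₀ := 2 * (16 * n / k)) hk hkn ht htk
    (Real.exp_pos _) (by rw [Real.exp_le_one_iff]; linarith) (by positivity) hy ?_ ?_
  · intro G W hsat S hS hsS
    rw [hD] at hsat
    exact sum_exp_degIn_le_of_le_one G W hk0 hq hD' hD'1 hDD hsat S hS hsS
  · have h1 : k * (2 * (16 * n / k) / (Real.exp (-(D' / 32768)) * n)) ≤ 64 := by
      calc k * (2 * (16 * n / k) / (Real.exp (-(D' / 32768)) * n))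
          ≤ k * (2 * (16 * n / k) / (1 / 2 * n)) := by gcongr
        _ = 64 := by field_simp; norm_num
    rw [← Real.exp_nat_mul, ← Real.exp_add]
    calc 8 * Real.exp _ ≤ Real.exp 3 * Real.exp _ := by gcongr; exact eight_le_exp_three
      _ = Real.exp (3 + _) := (Real.exp_add _ _).symm
      _ < _ := by
        rw [Real.exp_lt_exp]
        have h2 : D' / 32768 * (k / 8) ≤ D' / 32768 * (k / 4 : ℕ) := by gcongr
        have h3 : 2 * y * k ≤ D' / 32768 / 16 * k := by gcongr
        linarith

lemma zeta_lt_exp_of_large {n k t : ℕ} {D y : ℝ} (hk : 16 ≤ k) (hkn : 2 * (k : ℝ) ^ 2 ≤ n)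
    (ht : 0 < t) (htk : 8 * (n : ℝ) ≤ t * k) (hD : t * k ^ 3 / n ^ 2 = D)
    (hDlarge : Real.exp 160 < D) (hy : 0 ≤ y) (hyD : 2 * y ≤ Real.log D / 128) :
    zeta n k t < Real.exp (-(y * t * k)) := by
  rcases (packings (Fin n) k t).eq_empty_or_nonempty with hempty | hne
  · rw [zeta_eq, hempty]
    simpa using Real.exp_pos _
  have hk0 : (0 : ℝ) < k := by exact_mod_cast (by omega : 0 < k)
  have hk16 : (16 : ℝ) ≤ k := by exact_mod_cast hk
  have hn : (0 : ℝ) < n := lt_of_lt_of_le (by positivity) hkn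
  have hq := div_eight_le_div_four (by omega : 8 ≤ k)
  have hDpos : 0 < D := (Real.exp_pos _).trans hDlarge
  have hL : 160 < Real.log D := (Real.lt_log_iff_exp_lt hDpos).2 hDlarge
  have hD2k : D ≤ 2 * k := by
    have h1 := mul_le_of_packing_nonempty hne
    rw [Fintype.card_fin] at h1
    have h2 : (t : ℝ) * (k * k - k) ≤ n * n := by
      rw [← Nat.cast_mul k k, ← Nat.cast_sub (Nat.le_mul_self k)]
      exact_mod_cast h1
    rw [← hD, div_le_iff₀ (by positivity)]
    have h3 : (t : ℝ) * k ^ 3 ≤ 2 * k * (t * (k * k - k)) := by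
      have : (0 : ℝ) ≤ t * k ^ 2 * (k - 2) := by
        have : (0 : ℝ) ≤ k - 2 := by linarith
        positivity
      nlinarith
    calc (t : ℝ) * k ^ 3 ≤ 2 * k * (t * (k * k - k)) := h3
      _ ≤ 2 * k * (n * n) := by gcongr
      _ = 2 * k * n ^ 2 := by ring
  obtain ⟨ρ, hρdef⟩ : ∃ ρ, ρ = Real.exp (-(Real.log D / 8)) := ⟨_, rfl⟩
  have hρ : 0 < ρ := hρdef ▸ Real.exp_pos _
  have hρD : ρ ^ 8 * D = 1 := by
    rw [hρdef, ← Real.exp_nat_mul]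
    nth_rewrite 2 [← Real.exp_log hDpos]
    rw [← Real.exp_add, Real.exp_eq_one_iff]
    push_cast
    ring
  have hρ1 : ρ ≤ 1 / 100 := by
    calc ρ ≤ Real.exp (-(3 * 3)) := by
          rw [hρdef, Real.exp_le_exp]; linarith
      _ = (Real.exp 3 ^ 3)⁻¹ := by rw [← Real.exp_nat_mul, ← Real.exp_neg]; norm_num
      _ ≤ (8 ^ 3)⁻¹ := by
          gcongr
          exact eight_le_exp_three
      _ ≤ 1 / 100 := by norm_num
  refine zeta_lt_exp (ρ := ρ) (s₀ := 16 * n / k / ρ ^ 4) (by omega) hkn ht htk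
    hρ (by linarith) (by positivity) hy ?_ ?_
  · intro G W hsat S hS hsS
    rw [hD] at hsat
    exact sum_exp_degIn_le_of_small G W hk0 hq hρ hρ1 hρD hsat S hS hsS
  · have h1 : k * (16 * n / k / ρ ^ 4 / (ρ * n)) ≤ (k : ℝ) := by
      have e1 : k * (16 * n / k / ρ ^ 4 / (ρ * n)) = 16 / ρ ^ 5 := by field_simp
      rw [e1, div_le_iff₀ (by positivity)]
      have h2 : 32 * ρ ^ 3 ≤ 1 := by
        have : ρ ^ 3 ≤ (1 / 100) ^ 3 := by gcongr
        linarith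
      have h3 : 1 ≤ ρ ^ 8 * (2 * k) := by
        rw [← hρD]; gcongr
      have h4 : 32 * ρ ^ 3 ≤ ρ ^ 3 * (2 * (k * ρ ^ 5)) := by
        calc 32 * ρ ^ 3 ≤ 1 := h2
          _ ≤ ρ ^ 8 * (2 * k) := h3
          _ = _ := by ring
      have h5 : (0 : ℝ) < ρ ^ 3 := by positivity
      nlinarith
    have h2 : ρ ^ (k / 4) = Real.exp ((k / 4 : ℕ) * -(Real.log D / 8)) := by
      rw [hρdef, ← Real.exp_nat_mul]
    rw [h2, ← Real.exp_add]
    calc 8 * Real.exp _ ≤ Real.exp 3 * Real.exp _ := by gcongr; exact eight_le_exp_three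
      _ = Real.exp (3 + _) := (Real.exp_add _ _).symm
      _ < _ := by
        rw [Real.exp_lt_exp]
        have h3 : Real.log D / 8 * (k / 8) ≤ Real.log D / 8 * (k / 4 : ℕ) := by gcongr
        have h4 : 2 * y * k ≤ Real.log D / 128 * k := by gcongr
        have h5 : 160 * (k : ℝ) < Real.log D * k := by gcongr
        linarith

end Assembly

/-- There is `β > 0` such that: for every `d₀ > 0` there are `ε > 0` and `N` so that
for all `n ≥ N`, integers `k` with `1/ε ≤ k ≤ ε√n`, and reals `D ≥ d₀` for which
`t = D·n²/k³` is a positive integer, `ζ(n,k,t) < exp(-βDtk)` if `D ≤ e`, and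
`ζ(n,k,t) < exp(-β(log D)tk)` if `D > e`. -/
theorem stmt2 :
    ∃ β : ℝ, 0 < β ∧ ∀ d₀ : ℝ, 0 < d₀ → ∃ ε : ℝ, 0 < ε ∧ ∃ N : ℕ, ∀ n, N ≤ n →
      ∀ k : ℕ, 1 / ε ≤ (k : ℝ) → (k : ℝ) ≤ ε * Real.sqrt n →
        ∀ D : ℝ, d₀ ≤ D → ∀ t : ℕ, 0 < t → (t : ℝ) = D * (n : ℝ) ^ 2 / (k : ℝ) ^ 3 →
          (D ≤ Real.exp 1 →
              zeta n k t < Real.exp (-(β * D * (t : ℝ) * (k : ℝ)))) ∧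
          (Real.exp 1 < D →
              zeta n k t < Real.exp (-(β * Real.log D * (t : ℝ) * (k : ℝ)))) := by
  refine ⟨1 / (1048576 * Real.exp 160), by positivity, fun d₀ hd₀ => ?_⟩
  set β : ℝ := 1 / (1048576 * Real.exp 160) with hβ
  have hβ0 : 0 < β := by positivity
  have hE : 1 ≤ Real.exp 160 := Real.one_le_exp (by norm_num)
  have hm : 0 < min d₀ 1 := lt_min hd₀ one_pos
  set ε : ℝ := min d₀ 1 / 40000000 with hε
  have hε0 : 0 < ε := by positivity
  have hε1 : ε ≤ 1 / 40000000 := by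
    have := min_le_right d₀ 1
    rw [hε]; linarith
  have hεd : ε ≤ d₀ := by
    have := min_le_left d₀ 1
    rw [hε]; linarith
  refine ⟨ε, hε0, 0, fun n _ k hk1 hk2 D hD t ht htD => ?_⟩
  have hεk : 1 ≤ ε * k := by
    rw [div_le_iff₀ hε0] at hk1; linarith
  have hk0 : (0 : ℝ) < k := lt_of_lt_of_le (by positivity) hk1
  have hk16' : (16 : ℝ) ≤ k := by nlinarith
  have hk16 : 16 ≤ k := by exact_mod_cast hk16'
  have hksq : (k : ℝ) ^ 2 ≤ ε ^ 2 * n := by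
    calc (k : ℝ) ^ 2 ≤ (ε * √n) ^ 2 := by gcongr
      _ = ε ^ 2 * n := by rw [mul_pow, Real.sq_sqrt (Nat.cast_nonneg n)]
  have hn : (0 : ℝ) < n := by
    by_contra! h
    have h1 : 0 < (k : ℝ) ^ 2 := by positivity
    nlinarith [sq_nonneg ε]
  have hD0 : 0 < D := hd₀.trans_le hD
  have hkn : 2 * (k : ℝ) ^ 2 ≤ n := by
    have : ε ^ 2 ≤ 1 / 2 := by nlinarith
    nlinarith
  have hDeq : (t : ℝ) * k ^ 3 / n ^ 2 = D := by rw [htD]; field_simp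
  have htk : 8 * (n : ℝ) ≤ t * k := by
    have e : (t : ℝ) * k = D * n ^ 2 / k ^ 2 := by rw [htD]; field_simp
    rw [e, le_div_iff₀ (by positivity)]
    have h1 : 8 * ε ^ 2 ≤ D := by nlinarith
    calc 8 * (n : ℝ) * k ^ 2 ≤ 8 * n * (ε ^ 2 * n) := by gcongr
      _ = 8 * ε ^ 2 * n ^ 2 := by ring
      _ ≤ D * n ^ 2 := by gcongr
  have hbounded : D ≤ Real.exp 160 → ∀ f : ℝ, 0 ≤ f → f ≤ D →
      zeta n k t < Real.exp (-(β * f * (t : ℝ) * (k : ℝ))) := by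
    intro hDle f hf hfD
    refine zeta_lt_exp_of_bounded (D := D) (D' := min D 1) (by omega) hkn ht htk hDeq
      (by positivity) (min_le_right _ _) (min_le_left _ _) (by positivity) ?_ ?_
    · have h1 : D ≤ Real.exp 160 * min D 1 := by
        rcases le_total D 1 with h | h
        · rw [min_eq_left h]; nlinarith
        · rw [min_eq_right h]; linarith
      calc 2 * (β * f) ≤ 2 * (β * (Real.exp 160 * min D 1)) := by gcongr; exact hfD.trans h1
        _ = min D 1 / 32768 / 16 := by rw [hβ]; field_simp; norm_num
    · have h1 : min d₀ 1 ≤ min D 1 := min_le_min_right 1 hD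
      have h2 : 40000000 ≤ min d₀ 1 * k := by
        have : ε * k = min d₀ 1 * k / 40000000 := by rw [hε]; ring
        linarith
      have h3 : min d₀ 1 * (k : ℝ) ≤ min D 1 * k := by gcongr
      linarith
  refine ⟨fun hDe => ?_, fun hDe => ?_⟩
  · exact hbounded (hDe.trans (Real.exp_le_exp.2 (by norm_num))) D hD0.le le_rfl
  · have hlog : 0 ≤ Real.log D :=
      Real.log_nonneg ((Real.one_le_exp zero_le_one).trans hDe.le)
    rcases le_or_gt D (Real.exp 160) with hDle | hDgt
    · exact hbounded hDle _ hlog (Real.log_le_self hD0.le)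
    · refine zeta_lt_exp_of_large (D := D) hk16 hkn ht htk hDeq hDgt (by positivity) ?_
      have h1 : β ≤ 1 / 256 := by
        rw [hβ]
        exact one_div_le_one_div_of_le (by norm_num) (by linarith)
      nlinarith
end
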